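/- Skein relation, sum form (Theorem, second equation): let 1 ≤ j < i_1 < i_2 < … < i_r ≤ n, I = {i_1,…,i_r}, and 1 ≤ k ≤ r. Let (G_+, G_−, G_0, G_∞) be a skein quadruple of Gauss diagrams on n strings at a crossing between strings j and i_k. Then Z_{I,j}(G_+) − Z_{I,j}(G_−) = Σ_{m=1}^{k} Z_{I_m^-, j}(G_+) · Z_{I_m^+, i_k}(G_0), where for m = 1,…,k one sets I_m^- = {i_1,…,i_{m−1}} and I_m^+ = {i_m,…,i_{k−1}, i_{k+1},…,i_r}; moreover Z_{I_m^-, j}(G_+) = Z_{I_m^-, j}(G_−) for each such m, so the right-hand side may equivalently be computed from G_−. -/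

import Mathlib

/-!
Combinatorial Gauss diagrams on `n` strings and the tree invariants `Z I j`.

A Gauss diagram is encoded by a finite set of arrows; each arrow records the
string (an element of `Fin n`) and the position (a rational number, increasing
in the direction of the orientation of the string) of its tail and of its head,
together with a sign `±1`.  Only the induced combinatorial data (linear order of
the endpoints along each string, the tail/head pairing and the signs) is ever
used by the definitions below.

The tree invariant `Z I j G = ∑_{A ∈ 𝒜_{I,j}} sign(A) ⟨A, G⟩` is computed as a
signed count over all subsets `S` of the arrows of `G` that form a planar tree
diagram with leaves on `I` and trunk on `j`: each pair `(A, φ)` of a planar tree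
diagram `A ∈ 𝒜_{I,j}` together with an embedding `φ : A → G` corresponds
bijectively to the subset `S = Im φ` of the arrows of `G`, which is itself a
planar tree diagram with leaves on `I` and trunk on `j`; the contribution of the
pair to the sum is `sign(A) · sign(φ) = (-1)^{#right-pointing arrows of S} · ∏_{a ∈ S} sign(a)`.
-/

open scoped Classical

/-- An arrow of a Gauss diagram on `n` strings: a tail endpoint, a head
endpoint (each given by the string it lies on and its position along that
string) and a sign. -/
structure GArrow (n : ℕ) where
  tailStr : Fin n
  tailPos : ℚ
  headStr : Fin n
  headPos : ℚ
  sign : ℤ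
deriving DecidableEq

namespace GArrow

/-- The two endpoints of an arrow: `false` is the tail, `true` is the head. -/
def ep {n : ℕ} (a : GArrow n) : Bool → Fin n × ℚ
  | false => (a.tailStr, a.tailPos)
  | true => (a.headStr, a.headPos)

end GArrow

/-- A Gauss diagram on `n` strings: a finite set of signed arrows with all
endpoints pairwise distinct, and all signs equal to `±1`. -/
structure GaussDiagram (n : ℕ) where
  arrows : Finset (GArrow n)
  sign_pm : ∀ a ∈ arrows, a.sign = 1 ∨ a.sign = -1
  endpoints_distinct : ∀ a ∈ arrows, ∀ b ∈ arrows, ∀ s t : Bool,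
    a.ep s = b.ep t → a = b ∧ s = t

/-- `S` is a tree diagram with leaves on `I` and trunk on `j`:
* the head and the tail of every arrow lie on different strings;
* for each `i ∈ I` there is exactly one arrow tail on string `i`, and there are
  no arrow tails on strings outside `I`;
* every arrow head lies on a string of `I ∪ {j}`;
* on each string `i ∈ I` all arrow heads precede the unique arrow tail. -/
def IsTreeDiagram {n : ℕ} (I : Finset (Fin n)) (j : Fin n)
    (S : Finset (GArrow n)) : Prop :=
  (∀ a ∈ S, a.tailStr ≠ a.headStr) ∧
  (∀ i ∈ I, ∃! a, a ∈ S ∧ a.tailStr = i) ∧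
  (∀ a ∈ S, a.tailStr ∈ I) ∧
  (∀ a ∈ S, a.headStr ∈ I ∨ a.headStr = j) ∧
  (∀ a ∈ S, ∀ b ∈ S, a.headStr = b.tailStr → a.headPos < b.tailPos)

/-- `ParentRel S s t` : string `s` is the parent of string `t` in the rooted
tree determined by the tree diagram `S`, i.e. the (unique) arrow with tail on
`t` has its head on `s`. -/
def ParentRel {n : ℕ} (S : Finset (GArrow n)) (s t : Fin n) : Prop :=
  ∃ a ∈ S, a.tailStr = t ∧ a.headStr = s

/-- `Descends S s k` : string `k` belongs to the subtree of string `s` (it is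
`s` itself or an iterated child of `s`). -/
def Descends {n : ℕ} (S : Finset (GArrow n)) : Fin n → Fin n → Prop :=
  Relation.ReflTransGen (ParentRel S)

/-- `S` is a *planar* tree diagram with leaves on `I` and trunk on `j`: the
rooted tree `T_S` determined by `S` can be drawn in the plane so that the
clockwise order of its leaves, starting from the root on string `j`, is the
order of the string numbers.  Combinatorially this says that:
* the parent relation makes the strings carrying the arrows into a tree rooted
  at `j` (every leaf string is an iterated child of `j`);
* the whole subtree hanging from an arrow lies on the same side of the string
  carrying the head of that arrow as its tail does;
* two subtrees hanging on the same side of a common string are ordered, along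
  that string, compatibly with the order of the strings: for two arrow heads on
  the same string, with both tails on the left, the subtree attached closer to
  the beginning of the string is the one carrying the larger string numbers,
  while for two tails on the right it is the one carrying the smaller string
  numbers. -/
def IsPlanarTreeDiagram {n : ℕ} (I : Finset (Fin n)) (j : Fin n)
    (S : Finset (GArrow n)) : Prop :=
  IsTreeDiagram I j S ∧
  (∀ i ∈ I, Relation.TransGen (ParentRel S) j i) ∧
  (∀ a ∈ S, ∀ k : Fin n, Descends S a.tailStr k →
    (a.tailStr < a.headStr ↔ k < a.headStr)) ∧
  (∀ a ∈ S, ∀ b ∈ S, a.headStr = b.headStr → a.headPos < b.headPos →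
    ∀ k k' : Fin n, Descends S a.tailStr k → Descends S b.tailStr k' →
      ((a.tailStr < a.headStr → b.tailStr < b.headStr → k' < k) ∧
       (a.headStr < a.tailStr → b.headStr < b.tailStr → k < k')))

/-- The sign `(-1)^q` of an (embedded) arrow diagram, where `q` is the number
of right-pointing arrows (tail on a string of smaller number than the head). -/
noncomputable def treeSign {n : ℕ} (S : Finset (GArrow n)) : ℤ :=
  (-1) ^ (S.filter fun a => a.tailStr < a.headStr).card

/-- The tree invariant `Z_{I,j}(G) = ∑_{A ∈ 𝒜_{I,j}} sign(A)·⟨A,G⟩`, computed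
as the signed count of embedded planar tree diagrams with leaves on `I` and
trunk on `j` inside `G`.  In particular `Z ∅ j G = 1` (only `S = ∅`
contributes). -/
noncomputable def Z {n : ℕ} (I : Finset (Fin n)) (j : Fin n)
    (G : GaussDiagram n) : ℤ :=
  ∑ S ∈ G.arrows.powerset,
    if IsPlanarTreeDiagram I j S then treeSign S * ∏ a ∈ S, a.sign else 0

/-- Reversing the orientation of string `i`: the linear order of the endpoints
on string `i` is reversed (positions are negated) and the sign of every arrow
with exactly one endpoint on string `i` is multiplied by `-1`. -/
def reverseArrow {n : ℕ} (i : Fin n) (a : GArrow n) : GArrow n where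
  tailStr := a.tailStr
  tailPos := if a.tailStr = i then -a.tailPos else a.tailPos
  headStr := a.headStr
  headPos := if a.headStr = i then -a.headPos else a.headPos
  sign := if (a.tailStr = i ∧ a.headStr ≠ i) ∨ (a.tailStr ≠ i ∧ a.headStr = i)
    then -a.sign else a.sign

/-- The position of the endpoint of the arrow `a` lying on string `s` (for an
arrow joining `s` to a different string). -/
def posOn {n : ℕ} (a : GArrow n) (s : Fin n) : ℚ :=
  if a.tailStr = s then a.tailPos else a.headPos

/-- The oriented smoothing at a crossing of strings `j` and `i` located at
position `pj` on string `j` and position `pi` on string `i`: the final portions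
of the two strings are exchanged, i.e. an endpoint on string `j` after `pj`
moves to string `i` (after `pi`, in the same order) and vice versa. -/
def smoothEp {n : ℕ} (j i : Fin n) (pj pi : ℚ) (e : Fin n × ℚ) : Fin n × ℚ :=
  if e.1 = j ∧ pj < e.2 then (i, pi + (e.2 - pj))
  else if e.1 = i ∧ pi < e.2 then (j, pj + (e.2 - pi))
  else e

/-- The effect of the oriented smoothing on an arrow. -/
def smoothArrow {n : ℕ} (j i : Fin n) (pj pi : ℚ) (a : GArrow n) : GArrow n where
  tailStr := (smoothEp j i pj pi (a.tailStr, a.tailPos)).1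
  tailPos := (smoothEp j i pj pi (a.tailStr, a.tailPos)).2
  headStr := (smoothEp j i pj pi (a.headStr, a.headPos)).1
  headPos := (smoothEp j i pj pi (a.headStr, a.headPos)).2
  sign := a.sign

/-- `(Gp, Gm, G0, Ginf)` is a skein quadruple at a crossing between strings `j`
and `i`:
* `Gp` has a distinguished arrow `a` of sign `+1` joining strings `j` and `i`
  (in either direction);
* `Gm` is obtained from `Gp` by switching the crossing (exchanging the tail and
  the head of `a` and changing its sign to `-1`);
* `G0` is obtained by deleting `a` and exchanging the final portions of strings
  `j` and `i` at the positions of `a` (the oriented smoothing);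
* `Ginf` is obtained by first reversing the orientation of string `i` and then
  smoothing at `a` respecting the new orientations. -/
def IsSkeinQuadruple {n : ℕ} (j i : Fin n) (Gp Gm G0 Ginf : GaussDiagram n) :
    Prop :=
  j ≠ i ∧
  ∃ a ∈ Gp.arrows, a.sign = 1 ∧
    ((a.tailStr = j ∧ a.headStr = i) ∨ (a.tailStr = i ∧ a.headStr = j)) ∧
    Gm.arrows =
      insert (GArrow.mk a.headStr a.headPos a.tailStr a.tailPos (-1))
        (Gp.arrows.erase a) ∧
    G0.arrows =
      (Gp.arrows.erase a).image (smoothArrow j i (posOn a j) (posOn a i)) ∧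
    Ginf.arrows =
      ((Gp.arrows.image (reverseArrow i)).erase (reverseArrow i a)).image
        (smoothArrow j i (posOn a j) (-(posOn a i)))

/-- Compatibility of a cut `c` with a family of blocks `D a` (`a ∈ A`), labelled by `t a` and
placed at `q a`, relative to a central block `E` containing `i` and placed at `p`: the blocks
below `c` increase with their position, the blocks above `c` lie beyond `p` and are arranged
planarly around `E`. -/
structure CutValid {α β : Type*} [LinearOrder α] (A : Finset β) (t : β → α) (q : β → ℚ)
    (D : β → α → Prop) (E : α → Prop) (i : α) (p : ℚ) (c : α) : Prop where
  low : ∀ a ∈ A, t a < c → ∀ k, D a k → k < c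
  high : ∀ a ∈ A, c ≤ t a → ∀ k, D a k → c ≤ k
  root : ∀ x, E x → c ≤ x
  low_order : ∀ a ∈ A, ∀ b ∈ A, t a < c → t b < c → q a < q b →
    ∀ k k', D a k → D b k' → k < k'
  pos : ∀ a ∈ A, c ≤ t a → p < q a
  side : ∀ a ∈ A, c ≤ t a → ∀ k, D a k → (t a < i ↔ k < i)
  high_left : ∀ a ∈ A, ∀ b ∈ A, c ≤ t a → c ≤ t b → q a < q b → t a < i → t b < i →
    ∀ k k', D a k → D b k' → k' < k
  high_right : ∀ a ∈ A, ∀ b ∈ A, c ≤ t a → c ≤ t b → q a < q b → i < t a → i < t b →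
    ∀ k k', D a k → D b k' → k < k'
  root_left : ∀ a ∈ A, c ≤ t a → t a < i → ∀ k x, D a k → E x → k < x
  root_right : ∀ a ∈ A, c ≤ t a → i < t a → ∀ k x, D a k → E x → x < k

/-- The blocks `D a`, together with the central block `E` at position `p`, are ordered
increasingly with their positions. -/
structure BlocksOrdered {α β : Type*} [LinearOrder α] (A : Finset β) (q : β → ℚ)
    (D : β → α → Prop) (E : α → Prop) (p : ℚ) : Prop where
  order : ∀ a ∈ A, ∀ b ∈ A, q a < q b → ∀ k k', D a k → D b k' → k < k'
  before : ∀ a ∈ A, q a < p → ∀ k x, D a k → E x → k < x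
  after : ∀ a ∈ A, p < q a → ∀ k x, D a k → E x → x < k

section Cuts

variable {α β : Type*} [LinearOrder α] {A : Finset β} {t : β → α} {q : β → ℚ}
  {D : β → α → Prop} {E : α → Prop} {i : α} {p : ℚ} {I : Finset α}

theorem CutValid.eq_min {c e : α} (h : CutValid A t q D E i p c)
    (hcov : ∀ x ∈ I, E x ∨ ∃ a ∈ A, D a x) (hEi : E i)
    (hX : ∀ a ∈ A, p < q a → ¬ t a < i) (hc : c ∈ I)
    (he : E e) (hmin : ∀ x, E x → e ≤ x) : c = e := by
  have hce := h.root e he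
  by_contra hne
  have hlt : c < e := lt_of_le_of_ne hce hne
  rcases hcov c hc with hE | ⟨a, ha, hD⟩
  · exact absurd (hmin c hE) (not_le.2 hlt)
  · have hta : c ≤ t a := by
      by_contra hh
      exact lt_irrefl _ (h.low a ha (not_le.1 hh) c hD)
    exact hX a ha (h.pos a ha hta) ((h.side a ha hta c hD).2 (hlt.trans_le (hmin i hEi)))

theorem cutValid_min_iff {e : α} (hDt : ∀ a ∈ A, D a (t a)) (hEi : E i)
    (hti : ∀ a ∈ A, t a ≠ i) (hqp : ∀ a ∈ A, q a ≠ p)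
    (hX : ∀ a ∈ A, p < q a → ¬ t a < i)
    (he : E e) (hmin : ∀ x, E x → e ≤ x) :
    CutValid A t q D E i p e ↔ BlocksOrdered A q D E p := by
  have hei := hmin i hEi
  constructor
  · intro h
    have hhigh : ∀ a ∈ A, p < q a → i < t a := fun a ha hq =>
      lt_of_le_of_ne (not_lt.1 (hX a ha hq)) (hti a ha).symm
    have hlow : ∀ a ∈ A, q a < p → t a < e := fun a ha hq => by
      by_contra hh
      exact lt_asymm hq (h.pos a ha (not_lt.1 hh))
    refine ⟨?_, ?_, ?_⟩
    · intro a ha b hb hq k k' hk hk'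
      rcases lt_or_gt_of_ne (hqp a ha) with h1 | h1
      · have ta := hlow a ha h1
        rcases lt_or_gt_of_ne (hqp b hb) with h2 | h2
        · exact h.low_order a ha b hb ta (hlow b hb h2) hq k k' hk hk'
        · exact (h.low a ha ta k hk).trans_le
            (h.high b hb (hei.trans (hhigh b hb h2).le) k' hk')
      · have h2 := h1.trans hq
        have ia := hhigh a ha h1
        have ib := hhigh b hb h2
        exact h.high_right a ha b hb (hei.trans ia.le) (hei.trans ib.le) hq ia ib k k' hk hk'
    · intro a ha hq k x hk hx
      exact (h.low a ha (hlow a ha hq) k hk).trans_le (hmin x hx)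
    · intro a ha hq k x hk hx
      have ia := hhigh a ha hq
      exact h.root_right a ha (hei.trans ia.le) ia k x hk hx
  · intro h
    have hpos : ∀ a ∈ A, ∀ k, D a k → e ≤ k → p < q a := fun a ha k hk hek => by
      rcases lt_or_gt_of_ne (hqp a ha) with h1 | h1
      · exact absurd (h.before a ha h1 k e hk he) (not_lt.2 hek)
      · exact h1
    have hpos' : ∀ a ∈ A, e ≤ t a → p < q a := fun a ha hta => hpos a ha _ (hDt a ha) hta
    have hnl : ∀ a ∈ A, e ≤ t a → ¬ t a < i := fun a ha hta => hX a ha (hpos' a ha hta)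
    refine ⟨?_, ?_, hmin, ?_, hpos', ?_, ?_, ?_, ?_, ?_⟩
    · intro a ha hta k hk
      by_contra hh
      have := h.after a ha (hpos a ha k hk (not_lt.1 hh)) (t a) e (hDt a ha) he
      exact lt_asymm this hta
    · intro a ha hta k hk
      exact (h.after a ha (hpos' a ha hta) k e hk he).le
    · intro a ha b hb _ _ hq
      exact h.order a ha b hb hq
    · intro a ha hta k hk
      exact ⟨fun hh => absurd hh (hnl a ha hta), fun hh =>
        absurd hh (h.after a ha (hpos' a ha hta) k i hk hEi).not_gt⟩
    · intro a ha b hb hta _ _ hh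
      exact absurd hh (hnl a ha hta)
    · intro a ha b hb _ _ hq _ _
      exact h.order a ha b hb hq
    · intro a ha hta hh
      exact absurd hh (hnl a ha hta)
    · intro a ha hta _ k x hk hx
      exact h.after a ha (hpos' a ha hta) k x hk hx

theorem CutValid.eq_or_eq {c l m : α} {a₀ : β} (h : CutValid A t q D E i p c)
    (hcov : ∀ x ∈ I, E x ∨ ∃ a ∈ A, D a x) (hEi : E i) (hq : Set.InjOn q A)
    (ha₀ : a₀ ∈ A) (hp₀ : p < q a₀) (ht₀ : t a₀ < i)
    (hmax : ∀ a ∈ A, p < q a → t a < i → q a ≤ q a₀)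
    (hl : D a₀ l) (hlmin : ∀ k, D a₀ k → l ≤ k)
    (hmI : m ∈ I) (hm : ∀ k, D a₀ k → k < m) (hmmin : ∀ x ∈ I, (∀ k, D a₀ k → k < x) → m ≤ x)
    (hc : c ∈ I) : c = l ∨ c = m := by
  rcases lt_or_ge (t a₀) c with h0 | h0
  · right
    have hmc := hmmin c hc (h.low a₀ ha₀ h0)
    by_contra hne
    have hlt : m < c := lt_of_le_of_ne hmc (Ne.symm hne)
    rcases hcov m hmI with hE | ⟨a, ha, hD⟩
    · exact absurd (h.root m hE) (not_le.2 hlt)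
    · have hta : t a < c := by
        by_contra hh
        exact absurd (h.high a ha (not_lt.1 hh) m hD) (not_le.2 hlt)
      have hne : a ≠ a₀ := fun hh => lt_irrefl _ (hm m (hh ▸ hD))
      have hqn : q a ≠ q a₀ := fun hh => hne (hq ha ha₀ hh)
      rcases lt_or_gt_of_ne hqn with h1 | h1
      · exact lt_asymm (hm l hl) (h.low_order a ha a₀ ha₀ hta h0 h1 m l hD hl)
      · exact absurd (hmax a ha (hp₀.trans h1) (hta.trans_le (h.root i hEi))) (not_le.2 h1)
  · left
    have hcl := h.high a₀ ha₀ h0 l hl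
    by_contra hne
    have hlt : c < l := lt_of_le_of_ne hcl hne
    have hli : l < i := (h.side a₀ ha₀ h0 l hl).1 ht₀
    rcases hcov c hc with hE | ⟨a, ha, hD⟩
    · exact lt_asymm hlt (h.root_left a₀ ha₀ h0 ht₀ l c hl hE)
    · have hta : c ≤ t a := by
        by_contra hh
        exact lt_irrefl _ (h.low a ha (not_le.1 hh) c hD)
      have htai : t a < i := (h.side a ha hta c hD).2 (hlt.trans hli)
      have hne : a ≠ a₀ := fun hh => absurd (hlmin c (hh ▸ hD)) (not_le.2 hlt)
      have hqn : q a ≠ q a₀ := fun hh => hne (hq ha ha₀ hh)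
      have h1 := lt_of_le_of_ne (hmax a ha (h.pos a ha hta) htai) hqn
      exact lt_asymm hlt (h.high_left a ha a₀ ha₀ hta h0 h1 htai ht₀ c l hD hl)

theorem cutValid_swap {l m : α} {a₀ : β} (hDt : ∀ a ∈ A, D a (t a))
    (hDI : ∀ a ∈ A, ∀ x, D a x → x ∈ I)
    (hEI : ∀ x, E x → x ∈ I) (hEi : E i) (hti : ∀ a ∈ A, t a ≠ i) (hq : Set.InjOn q A)
    (ha₀ : a₀ ∈ A) (hp₀ : p < q a₀) (ht₀ : t a₀ < i)
    (hmax : ∀ a ∈ A, p < q a → t a < i → q a ≤ q a₀)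
    (hl : D a₀ l) (hlmin : ∀ k, D a₀ k → l ≤ k)
    (hm : ∀ k, D a₀ k → k < m) (hmmin : ∀ x ∈ I, (∀ k, D a₀ k → k < x) → m ≤ x) :
    CutValid A t q D E i p l ↔ CutValid A t q D E i p m := by
  have hl0 : l ≤ t a₀ := hlmin _ (hDt a₀ ha₀)
  have h0m : t a₀ < m := hm _ (hDt a₀ ha₀)
  have hlm : l < m := hm l hl
  have hlt : ∀ a ∈ A, a ≠ a₀ → p < q a → t a < i → q a < q a₀ := fun a ha hne h1 h2 =>
    lt_of_le_of_ne (hmax a ha h1 h2) fun hh => hne (hq ha ha₀ hh)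
  constructor
  · intro h
    have hEm : ∀ x, E x → m ≤ x := fun x hx =>
      hmmin x (hEI x hx) fun k hk => h.root_left a₀ ha₀ hl0 ht₀ k x hk hx
    have hmi := hEm i hEi
    have hhi : ∀ a ∈ A, a ≠ a₀ → l ≤ t a → ∀ k, D a k → m ≤ k := by
      intro a ha hne hta k hk
      refine hmmin k (hDI a ha k hk) fun k' hk' => ?_
      rcases lt_or_gt_of_ne (hti a ha) with h1 | h1
      · exact h.high_left a ha a₀ ha₀ hta hl0 (hlt a ha hne (h.pos a ha hta) h1) h1 ht₀ k k' hk hk'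
      · have hki : ¬ k < i := fun hh => lt_asymm h1 ((h.side a ha hta k hk).2 hh)
        exact ((h.side a₀ ha₀ hl0 k' hk').1 ht₀).trans_le (not_lt.1 hki)
    have hlo : ∀ a ∈ A, t a < m → a ≠ a₀ → t a < l := by
      intro a ha hta hne
      by_contra hh
      exact absurd (hhi a ha hne (not_lt.1 hh) _ (hDt a ha)) (not_le.2 hta)
    refine ⟨?_, ?_, hEm, ?_, ?_, ?_, ?_, ?_, ?_, ?_⟩
    · intro a ha hta k hk
      by_cases hne : a = a₀
      · exact hm k (hne ▸ hk)
      · exact (h.low a ha (hlo a ha hta hne) k hk).trans hlm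
    · intro a ha hta k hk
      have hne : a ≠ a₀ := fun hh => absurd (hh ▸ hta) (not_le.2 h0m)
      exact hhi a ha hne (hlm.le.trans hta) k hk
    · intro a ha b hb hta htb hqq k k' hk hk'
      by_cases hna : a = a₀
      · subst hna
        by_cases hnb : b = a
        · subst hnb; exact absurd hqq (lt_irrefl _)
        · have htb' := hlo b hb htb hnb
          exact absurd (hmax b hb (hp₀.trans hqq) ((htb'.trans hlm).trans_le hmi)) (not_le.2 hqq)
      · have hta' := hlo a ha hta hna
        by_cases hnb : b = a₀
        · subst hnb
          exact (h.low a ha hta' k hk).trans_le (hlmin k' hk')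
        · exact h.low_order a ha b hb hta' (hlo b hb htb hnb) hqq k k' hk hk'
    · exact fun a ha hta => h.pos a ha (hlm.le.trans hta)
    · exact fun a ha hta => h.side a ha (hlm.le.trans hta)
    · exact fun a ha b hb hta htb => h.high_left a ha b hb (hlm.le.trans hta) (hlm.le.trans htb)
    · exact fun a ha b hb hta htb => h.high_right a ha b hb (hlm.le.trans hta) (hlm.le.trans htb)
    · exact fun a ha hta => h.root_left a ha (hlm.le.trans hta)
    · exact fun a ha hta => h.root_right a ha (hlm.le.trans hta)
  · intro h
    have hmi := h.root i hEi
    have hlo : ∀ a ∈ A, t a < m → a ≠ a₀ → q a < q a₀ := by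
      intro a ha hta hne
      by_contra hh
      have h1 : q a₀ < q a := lt_of_le_of_ne (not_lt.1 hh) fun h' => hne (hq ha ha₀ h'.symm)
      exact absurd (hmax a ha (hp₀.trans h1) (hta.trans_le hmi)) (not_le.2 h1)
    have hlol : ∀ a ∈ A, t a < m → a ≠ a₀ → ∀ k, D a k → k < l := fun a ha hta hne k hk =>
      h.low_order a ha a₀ ha₀ hta h0m (hlo a ha hta hne) k l hk hl
    have hhi : ∀ a ∈ A, l ≤ t a → a ≠ a₀ → m ≤ t a := by
      intro a ha hta hne
      by_contra hh
      exact absurd (hlol a ha (not_le.1 hh) hne _ (hDt a ha)) (not_lt.2 hta)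
    refine ⟨?_, ?_, fun x hx => hlm.le.trans (h.root x hx), ?_, ?_, ?_, ?_, ?_, ?_, ?_⟩
    · intro a ha hta k hk
      have hne : a ≠ a₀ := fun hh => absurd (hh ▸ hta) (not_lt.2 hl0)
      exact hlol a ha (hta.trans hlm) hne k hk
    · intro a ha hta k hk
      by_cases hne : a = a₀
      · exact hlmin k (hne ▸ hk)
      · exact hlm.le.trans (h.high a ha (hhi a ha hta hne) k hk)
    · exact fun a ha b hb hta htb => h.low_order a ha b hb (hta.trans hlm) (htb.trans hlm)
    · intro a ha hta
      by_cases hne : a = a₀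
      · exact hne ▸ hp₀
      · exact h.pos a ha (hhi a ha hta hne)
    · intro a ha hta k hk
      by_cases hne : a = a₀
      · subst hne
        exact ⟨fun _ => (hm k hk).trans_le hmi, fun _ => ht₀⟩
      · exact h.side a ha (hhi a ha hta hne) k hk
    · intro a ha b hb hta htb hqq hai hbi k k' hk hk'
      by_cases hnb : b = a₀
      · subst hnb
        have hna : a ≠ b := fun hh => absurd (hh ▸ hqq) (lt_irrefl _)
        exact (hm k' hk').trans_le (h.high a ha (hhi a ha hta hna) k hk)
      · have hmb := hhi b hb htb hnb
        by_cases hna : a = a₀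
        · subst hna
          exact absurd (hmax b hb (h.pos b hb hmb) hbi) (not_le.2 hqq)
        · exact h.high_left a ha b hb (hhi a ha hta hna) hmb hqq hai hbi k k' hk hk'
    · intro a ha b hb hta htb hqq hai hbi
      have hna : a ≠ a₀ := fun hh => lt_asymm ht₀ (hh ▸ hai)
      have hnb : b ≠ a₀ := fun hh => lt_asymm ht₀ (hh ▸ hbi)
      exact h.high_right a ha b hb (hhi a ha hta hna) (hhi b hb htb hnb) hqq hai hbi
    · intro a ha hta hai k x hk hx
      by_cases hna : a = a₀
      · subst hna
        exact (hm k hk).trans_le (h.root x hx)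
      · exact h.root_left a ha (hhi a ha hta hna) hai k x hk hx
    · intro a ha hta hai
      have hna : a ≠ a₀ := fun hh => lt_asymm ht₀ (hh ▸ hai)
      exact h.root_right a ha (hhi a ha hta hna) hai

/-- The signed count of valid cuts is `1` if the blocks are ordered and `0` otherwise. -/
theorem sum_cutValid (hDt : ∀ a ∈ A, D a (t a))
    (hDI : ∀ a ∈ A, ∀ x, D a x → x ∈ I)
    (hEI : ∀ x, E x → x ∈ I) (hEi : E i) (hcov : ∀ x ∈ I, E x ∨ ∃ a ∈ A, D a x)
    (hti : ∀ a ∈ A, t a ≠ i) (hq : Set.InjOn q A) (hqp : ∀ a ∈ A, q a ≠ p) :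
    (∑ c ∈ I.filter (· ≤ i), if CutValid A t q D E i p c
      then (-1 : ℤ) ^ (A.filter fun a => c ≤ t a ∧ t a < i).card else 0)
      = if BlocksOrdered A q D E p then 1 else 0 := by
  by_cases hX : ∀ a ∈ A, p < q a → ¬ t a < i
  · obtain ⟨e, heF, hmin⟩ := (I.filter E).exists_min_image id
      ⟨i, Finset.mem_filter.2 ⟨hEI i hEi, hEi⟩⟩
    obtain ⟨heI, he⟩ := Finset.mem_filter.1 heF
    have hmin' : ∀ x, E x → e ≤ x := fun x hx => hmin x (Finset.mem_filter.2 ⟨hEI x hx, hx⟩)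
    rw [Finset.sum_eq_single e]
    · rw [cutValid_min_iff hDt hEi hti hqp hX he hmin']
      split_ifs with hB
      · have h := (cutValid_min_iff hDt hEi hti hqp hX he hmin').2 hB
        rw [Finset.filter_false_of_mem]
        · simp
        · rintro a ha ⟨h1, h2⟩
          exact hX a ha (h.pos a ha h1) h2
      · rfl
    · intro c hc hne
      rw [if_neg]
      exact fun h => hne (h.eq_min hcov hEi hX (Finset.mem_filter.1 hc).1 he hmin')
    · intro hh
      exact absurd (Finset.mem_filter.2 ⟨heI, hmin' i hEi⟩) hh
  · push Not at hX
    obtain ⟨a₁, ha₁, hp₁, ht₁⟩ := hX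
    rw [if_neg fun hB : BlocksOrdered A q D E p =>
      lt_asymm ht₁ (hB.after a₁ ha₁ hp₁ _ i (hDt a₁ ha₁) hEi)]
    obtain ⟨a₀, ha₀F, hmax⟩ := (A.filter fun a => p < q a ∧ t a < i).exists_max_image q
      ⟨a₁, Finset.mem_filter.2 ⟨ha₁, hp₁, ht₁⟩⟩
    obtain ⟨ha₀, hp₀, ht₀⟩ := Finset.mem_filter.1 ha₀F
    replace hmax : ∀ a ∈ A, p < q a → t a < i → q a ≤ q a₀ := fun a ha h1 h2 =>
      hmax a (Finset.mem_filter.2 ⟨ha, h1, h2⟩)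
    obtain ⟨l, hlF, hlmin⟩ := (I.filter (D a₀)).exists_min_image id
      ⟨t a₀, Finset.mem_filter.2 ⟨hDI a₀ ha₀ _ (hDt a₀ ha₀), hDt a₀ ha₀⟩⟩
    obtain ⟨hlI, hl⟩ := Finset.mem_filter.1 hlF
    replace hlmin : ∀ k, D a₀ k → l ≤ k := fun k hk =>
      hlmin k (Finset.mem_filter.2 ⟨hDI a₀ ha₀ k hk, hk⟩)
    by_cases hD0 : ∀ k, D a₀ k → k < i
    · obtain ⟨m, hmF, hmmin⟩ := (I.filter fun x => ∀ k, D a₀ k → k < x).exists_min_image id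
        ⟨i, Finset.mem_filter.2 ⟨hEI i hEi, hD0⟩⟩
      obtain ⟨hmI, hm⟩ := Finset.mem_filter.1 hmF
      replace hmmin : ∀ x ∈ I, (∀ k, D a₀ k → k < x) → m ≤ x := fun x hx h =>
        hmmin x (Finset.mem_filter.2 ⟨hx, h⟩)
      have hlm : l < m := hm l hl
      have hmi : m ≤ i := hmmin i (hEI i hEi) hD0
      rw [← Finset.sum_subset (s₁ := {l, m})]
      · rw [Finset.sum_pair hlm.ne, cutValid_swap hDt hDI hEI hEi hti hq ha₀ hp₀ ht₀ hmax hl hlmin hm hmmin]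
        split_ifs with h
        · have hh := (cutValid_swap hDt hDI hEI hEi hti hq ha₀ hp₀ ht₀ hmax hl hlmin hm hmmin).2 h
          have hins : (A.filter fun a => l ≤ t a ∧ t a < i)
              = insert a₀ (A.filter fun a => m ≤ t a ∧ t a < i) := by
            ext a
            simp only [Finset.mem_filter, Finset.mem_insert]
            constructor
            · rintro ⟨ha, h1, h2⟩
              by_cases hne : a = a₀
              · exact Or.inl hne
              · refine Or.inr ⟨ha, ?_, h2⟩
                by_contra h3
                have h4 : q a < q a₀ := lt_of_le_of_ne (hmax a ha (hh.pos a ha h1) h2)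
                  fun h' => hne (hq ha ha₀ h')
                exact absurd (h.low_order a ha a₀ ha₀ (not_le.1 h3) (hm _ (hDt a₀ ha₀)) h4 _ l
                  (hDt a ha) hl) (not_lt.2 h1)
            · rintro (rfl | ⟨ha, h1, h2⟩)
              · exact ⟨ha₀, hlmin _ (hDt a ha₀), ht₀⟩
              · exact ⟨ha, hlm.le.trans h1, h2⟩
          rw [hins, Finset.card_insert_of_notMem, pow_succ]
          · ring
          · intro h'
            exact absurd (Finset.mem_filter.1 h').2.1 (not_le.2 (hm _ (hDt a₀ ha₀)))
        · simp
      · intro x hx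
        rcases Finset.mem_insert.1 hx with rfl | hx
        · exact Finset.mem_filter.2 ⟨hlI, (hD0 x hl).le⟩
        · rw [Finset.mem_singleton.1 hx]
          exact Finset.mem_filter.2 ⟨hmI, hmi⟩
      · intro c hc hne
        rw [if_neg]
        intro h
        apply hne
        have := h.eq_or_eq hcov hEi hq ha₀ hp₀ ht₀ hmax hl hlmin hmI hm hmmin
          (Finset.mem_filter.1 hc).1
        simpa using this
    · refine Finset.sum_eq_zero fun c _ => if_neg fun h => hD0 fun k hk => ?_
      rcases lt_or_ge (t a₀) c with h0 | h0
      · exact (h.low a₀ ha₀ h0 k hk).trans_le (h.root i hEi)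
      · exact (h.side a₀ ha₀ h0 k hk).1 ht₀

end Cuts

theorem descends_congr {n : ℕ} {S S' : Finset (GArrow n)} {C : Fin n → Prop}
    (h : ∀ s, C s → ∀ t, ParentRel S s t ↔ ParentRel S' s t)
    (hC : ∀ s, C s → ∀ t, ParentRel S s t → C t) {s : Fin n} (hs : C s) (k : Fin n) :
    Descends S s k ↔ Descends S' s k := by
  constructor
  · intro hd
    induction hd using Relation.ReflTransGen.head_induction_on with
    | refl => exact .refl
    | head hp _ ih => exact .head ((h _ hs _).1 hp) (ih (hC _ hs _ hp))
  · intro hd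
    induction hd using Relation.ReflTransGen.head_induction_on with
    | refl => exact .refl
    | head hp _ ih =>
      have hp' := (h _ hs _).2 hp
      exact .head hp' (ih (hC _ hs _ hp'))

theorem Descends.closed {n : ℕ} {S : Finset (GArrow n)} {C : Fin n → Prop}
    (hC : ∀ s, C s → ∀ t, ParentRel S s t → C t) {s k : Fin n} (hd : Descends S s k)
    (hs : C s) : C k := by
  induction hd using Relation.ReflTransGen.head_induction_on with
  | refl => exact hs
  | head hp _ ih => exact ih (hC _ hs _ hp)

theorem Descends.mem {n : ℕ} {S : Finset (GArrow n)} {I : Finset (Fin n)}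
    (hS : ∀ a ∈ S, a.tailStr ∈ I) {s k : Fin n} (hd : Descends S s k) (hs : s ∈ I) : k ∈ I :=
  hd.closed (C := (· ∈ I)) (fun _ _ _ ⟨a, ha, h, _⟩ => h ▸ hS a ha) hs

theorem descends_iff {n : ℕ} {S : Finset (GArrow n)} {s k : Fin n} :
    Descends S s k ↔ k = s ∨ ∃ a ∈ S, a.headStr = s ∧ Descends S a.tailStr k := by
  constructor
  · intro h
    rcases Relation.ReflTransGen.cases_head h with rfl | ⟨_, ⟨a, ha, rfl, hs⟩, h⟩
    · exact Or.inl rfl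
    · exact Or.inr ⟨a, ha, hs, h⟩
  · rintro (rfl | ⟨a, ha, hs, h⟩)
    · exact .refl
    · exact .head ⟨a, ha, rfl, hs⟩ h

/-- The subtree of `t` lies on one side of the string `h`. -/
def SideCompat {n : ℕ} (S : Finset (GArrow n)) (h t : Fin n) : Prop :=
  ∀ k, Descends S t k → (t < h ↔ k < h)

/-- The subtrees of `t` and `t'`, attached in this order to the string `h`, do not cross. -/
def OrderCompat {n : ℕ} (S : Finset (GArrow n)) (h t t' : Fin n) : Prop :=
  ∀ k k', Descends S t k → Descends S t' k' →
    (t < h → t' < h → k' < k) ∧ (h < t → h < t' → k < k')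

theorem isPlanarTreeDiagram_iff {n : ℕ} {I : Finset (Fin n)} {j : Fin n}
    {S : Finset (GArrow n)} :
    IsPlanarTreeDiagram I j S ↔ IsTreeDiagram I j S ∧
      (∀ x ∈ I, ∃ a ∈ S, a.headStr = j ∧ Descends S a.tailStr x) ∧
      (∀ a ∈ S, SideCompat S a.headStr a.tailStr) ∧
      (∀ a ∈ S, ∀ b ∈ S, a.headStr = b.headStr → a.headPos < b.headPos →
        OrderCompat S a.headStr a.tailStr b.tailStr) := by
  unfold IsPlanarTreeDiagram SideCompat OrderCompat
  refine and_congr Iff.rfl (and_congr ?_ (and_congr Iff.rfl ?_))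
  · refine forall₂_congr fun x _ => ?_
    rw [Relation.TransGen.head'_iff]
    constructor
    · rintro ⟨_, ⟨a, ha, rfl, h⟩, hd⟩
      exact ⟨a, ha, h, hd⟩
    · rintro ⟨a, ha, h, hd⟩
      exact ⟨_, ⟨a, ha, rfl, h⟩, hd⟩
  · refine forall₄_congr fun a _ b _ => forall_congr' fun h => ?_
    rw [h]

/-- `U` is a planar forest whose roots lie on the strings `j` and `i`, the latter before the
position `p`; no condition is imposed on the planar arrangement along `j`. -/
structure IsTwoRootedForest {n : ℕ} (I : Finset (Fin n)) (j i : Fin n) (p : ℚ)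
    (U : Finset (GArrow n)) : Prop where
  ne : ∀ a ∈ U, a.tailStr ≠ a.headStr
  tail_unique : ∀ x ∈ I, x ≠ i → ∃! a, a ∈ U ∧ a.tailStr = x
  tail_mem : ∀ a ∈ U, a.tailStr ∈ I
  tail_ne : ∀ a ∈ U, a.tailStr ≠ i
  head_mem : ∀ a ∈ U, a.headStr ∈ I ∨ a.headStr = j
  precede : ∀ a ∈ U, ∀ b ∈ U, a.headStr = b.tailStr → a.headPos < b.tailPos
  head_pos : ∀ a ∈ U, a.headStr = i → a.headPos < p
  reach : ∀ x ∈ I, x ≠ i →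
    ∃ a ∈ U, (a.headStr = i ∨ a.headStr = j) ∧ Descends U a.tailStr x
  side : ∀ a ∈ U, a.headStr ≠ j → SideCompat U a.headStr a.tailStr
  order : ∀ a ∈ U, ∀ b ∈ U, a.headStr ≠ j → a.headStr = b.headStr → a.headPos < b.headPos →
    OrderCompat U a.headStr a.tailStr b.tailStr

theorem isPlanarTreeDiagram_insert_iff {n : ℕ} {I : Finset (Fin n)} {j i : Fin n}
    (hjI : ∀ x ∈ I, j < x) (hi : i ∈ I) {U : Finset (GArrow n)} {b : GArrow n}
    (hbt : b.tailStr = i) (hbh : b.headStr = j) (hbU : b ∉ U) :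
    IsPlanarTreeDiagram I j (insert b U) ↔ IsTwoRootedForest I j i b.tailPos U ∧
      BlocksOrdered (U.filter (·.headStr = j)) (·.headPos) (fun a => Descends U a.tailStr)
        (Descends U i) b.headPos := by
  have hpar : ∀ s, s ≠ j → ∀ t, ParentRel (insert b U) s t ↔ ParentRel U s t := by
    intro s hs t
    constructor
    · rintro ⟨a, ha, h1, h2⟩
      rcases Finset.mem_insert.1 ha with rfl | ha
      · exact absurd (h2.symm.trans hbh) hs
      · exact ⟨a, ha, h1, h2⟩
    · rintro ⟨a, ha, h1, h2⟩
      exact ⟨a, Finset.mem_insert_of_mem ha, h1, h2⟩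
  have hij : i ≠ j := (hjI i hi).ne'
  have hdesc : (∀ a ∈ U, a.tailStr ∈ I) → ∀ s ∈ I, ∀ k,
      Descends (insert b U) s k ↔ Descends U s k := by
    intro hU s hs k
    refine descends_congr (C := (· ∈ I)) (fun s hs => hpar s (hjI s hs).ne') ?_ hs k
    rintro s hs _ ⟨a, ha, rfl, -⟩
    rcases Finset.mem_insert.1 ha with rfl | ha
    · exact hbt ▸ hi
    · exact hU a ha
  rw [isPlanarTreeDiagram_iff]
  constructor
  · rintro ⟨⟨h1, h2, h3, h4, h5⟩, hr, hs, ho⟩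
    have hU : ∀ a ∈ U, a ∈ insert b U := fun a ha => Finset.mem_insert_of_mem ha
    have hb : b ∈ insert b U := Finset.mem_insert_self b U
    have hUI : ∀ a ∈ U, a.tailStr ∈ I := fun a ha => h3 a (hU a ha)
    have hd := hdesc hUI
    refine ⟨⟨fun a ha => h1 a (hU a ha), ?_, hUI, ?_, fun a ha => h4 a (hU a ha),
      fun a ha a' ha' => h5 a (hU a ha) a' (hU a' ha'), ?_, ?_, ?_, ?_⟩, ?_, ?_, ?_⟩
    · intro x hx hxi
      obtain ⟨a, ⟨ha, hax⟩, hau⟩ := h2 x hx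
      refine ⟨a, ⟨?_, hax⟩, fun y hy => hau y ⟨hU y hy.1, hy.2⟩⟩
      rcases Finset.mem_insert.1 ha with rfl | ha
      · exact absurd (hax.symm.trans hbt) hxi
      · exact ha
    · intro a ha hai
      have := (h2 i hi).unique ⟨hU a ha, hai⟩ ⟨hb, hbt⟩
      exact hbU (this ▸ ha)
    · intro a ha hai
      exact h5 a (hU a ha) b hb (hai.trans hbt.symm)
    · intro x hx hxi
      obtain ⟨a, ha, haj, hax⟩ := hr x hx
      rw [hd _ (h3 a ha)] at hax
      rcases Finset.mem_insert.1 ha with rfl | ha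
      · rw [hbt] at hax
        rcases descends_iff.1 hax with h | ⟨c, hc, hci, hcx⟩
        · exact absurd h hxi
        · exact ⟨c, hc, Or.inl hci, hcx⟩
      · exact ⟨a, ha, Or.inr haj, hax⟩
    · intro a ha _ k hk
      exact hs a (hU a ha) k ((hd _ (hUI a ha) k).2 hk)
    · intro a ha a' ha' _ hh hp k k' hk hk'
      exact ho a (hU a ha) a' (hU a' ha') hh hp k k' ((hd _ (hUI a ha) k).2 hk)
        ((hd _ (hUI a' ha') k').2 hk')
    · intro a ha a' ha' hp k k' hk hk'
      obtain ⟨ha, haj⟩ := Finset.mem_filter.1 ha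
      obtain ⟨ha', haj'⟩ := Finset.mem_filter.1 ha'
      refine (ho a (hU a ha) a' (hU a' ha') (haj.trans haj'.symm) hp k k'
        ((hd _ (hUI a ha) k).2 hk) ((hd _ (hUI a' ha') k').2 hk')).2 ?_ ?_
      · exact haj ▸ hjI _ (hUI a ha)
      · exact haj ▸ hjI _ (hUI a' ha')
    · intro a ha hp k x hk hx
      obtain ⟨ha, haj⟩ := Finset.mem_filter.1 ha
      refine (ho a (hU a ha) b hb (haj.trans hbh.symm) hp k x
        ((hd _ (hUI a ha) k).2 hk) ((hd _ (h3 b hb) x).2 (hbt ▸ hx))).2 ?_ ?_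
      · exact haj ▸ hjI _ (hUI a ha)
      · exact haj ▸ hjI _ (h3 b hb)
    · intro a ha hp k x hk hx
      obtain ⟨ha, haj⟩ := Finset.mem_filter.1 ha
      refine (ho b hb a (hU a ha) (hbh.trans haj.symm) hp x k
        ((hd _ (h3 b hb) x).2 (hbt ▸ hx)) ((hd _ (hUI a ha) k).2 hk)).2 ?_ ?_
      · exact hbh ▸ hjI _ (h3 b hb)
      · exact hbh ▸ hjI _ (hUI a ha)
  · rintro ⟨hF, hB⟩
    have hd := hdesc hF.tail_mem
    have htI : ∀ a ∈ insert b U, a.tailStr ∈ I := by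
      intro a ha
      rcases Finset.mem_insert.1 ha with rfl | ha
      · exact hbt ▸ hi
      · exact hF.tail_mem a ha
    have htne : ∀ a ∈ insert b U, a.headStr = i → a.headPos < b.tailPos := by
      intro a ha hai
      rcases Finset.mem_insert.1 ha with rfl | ha
      · exact absurd (hai.symm.trans hbh) hij
      · exact hF.head_pos a ha hai
    refine ⟨⟨?_, ?_, htI, ?_, ?_⟩, ?_, ?_, ?_⟩
    · intro a ha
      rcases Finset.mem_insert.1 ha with rfl | ha
      · rw [hbt, hbh]; exact hij
      · exact hF.ne a ha
    · intro x hx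
      by_cases hxi : x = i
      · refine ⟨b, ⟨Finset.mem_insert_self b U, hbt.trans hxi.symm⟩, ?_⟩
        rintro y ⟨hy, hyx⟩
        rcases Finset.mem_insert.1 hy with rfl | hy
        · rfl
        · exact absurd (hyx.trans hxi) (hF.tail_ne y hy)
      · obtain ⟨a, ⟨ha, hax⟩, hau⟩ := hF.tail_unique x hx hxi
        refine ⟨a, ⟨Finset.mem_insert_of_mem ha, hax⟩, ?_⟩
        rintro y ⟨hy, hyx⟩
        rcases Finset.mem_insert.1 hy with rfl | hy
        · exact absurd (hyx.symm.trans hbt) hxi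
        · exact hau y ⟨hy, hyx⟩
    · intro a ha
      rcases Finset.mem_insert.1 ha with rfl | ha
      · exact Or.inr hbh
      · exact hF.head_mem a ha
    · intro a ha a' ha' hh
      rcases Finset.mem_insert.1 ha' with rfl | ha'U
      · exact htne a ha (hh.trans hbt)
      · rcases Finset.mem_insert.1 ha with rfl | haU
        · exact absurd (hh.symm.trans hbh) (hjI _ (hF.tail_mem a' ha'U)).ne'
        · exact hF.precede a haU a' ha'U hh
    · intro x hx
      by_cases hxi : x = i
      · exact ⟨b, Finset.mem_insert_self b U, hbh, hbt.trans hxi.symm ▸ .refl⟩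
      · obtain ⟨a, ha, h | h, hax⟩ := hF.reach x hx hxi
        · refine ⟨b, Finset.mem_insert_self b U, hbh, ?_⟩
          rw [hbt, hd _ hi]
          exact descends_iff.2 (Or.inr ⟨a, ha, h, hax⟩)
        · exact ⟨a, Finset.mem_insert_of_mem ha, h, (hd _ (hF.tail_mem a ha) x).2 hax⟩
    · intro a ha k hk
      by_cases haj : a.headStr = j
      · rw [haj]
        exact ⟨fun h => absurd h (hjI _ (htI a ha)).not_gt,
          fun h => absurd h (hjI _ (hk.mem htI (htI a ha))).not_gt⟩
      · rcases Finset.mem_insert.1 ha with rfl | ha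
        · exact absurd hbh haj
        · exact hF.side a ha haj k ((hd _ (hF.tail_mem a ha) k).1 hk)
    · intro a ha a' ha' hh hp k k' hk hk'
      rw [hd _ (htI a ha)] at hk
      rw [hd _ (htI a' ha')] at hk'
      by_cases haj : a.headStr = j
      · refine ⟨fun h => absurd (haj ▸ h) (hjI _ (htI a ha)).not_gt, fun _ _ => ?_⟩
        have haj' := hh.symm.trans haj
        rcases Finset.mem_insert.1 ha with rfl | haU
        · rcases Finset.mem_insert.1 ha' with rfl | ha'U
          · exact absurd hp (lt_irrefl _)
          · exact hB.after a' (Finset.mem_filter.2 ⟨ha'U, haj'⟩) hp k' k hk' (hbt ▸ hk)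
        · rcases Finset.mem_insert.1 ha' with rfl | ha'U
          · exact hB.before a (Finset.mem_filter.2 ⟨haU, haj⟩) hp k k' hk (hbt ▸ hk')
          · exact hB.order a (Finset.mem_filter.2 ⟨haU, haj⟩) a'
              (Finset.mem_filter.2 ⟨ha'U, haj'⟩) hp k k' hk hk'
      · rcases Finset.mem_insert.1 ha with rfl | ha
        · exact absurd hbh haj
        · rcases Finset.mem_insert.1 ha' with rfl | ha'
          · exact absurd (hh.trans hbh) haj
          · exact hF.order a ha a' ha' haj hh hp k k' hk hk'

theorem smoothEp_of_ne {n : ℕ} {j i : Fin n} {pj pi : ℚ} {e : Fin n × ℚ}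
    (hj : e.1 ≠ j) (hi : e.1 ≠ i) : smoothEp j i pj pi e = e := by
  simp [smoothEp, hj, hi]

theorem smoothEp_eq_or {n : ℕ} (j i : Fin n) (pj pi : ℚ) (e : Fin n × ℚ) :
    (e.1 = j ∧ pj < e.2 ∧ smoothEp j i pj pi e = (i, pi + (e.2 - pj))) ∨
    (e.1 = i ∧ pi < e.2 ∧ smoothEp j i pj pi e = (j, pj + (e.2 - pi))) ∨
    ((e.1 = j → e.2 ≤ pj) ∧ (e.1 = i → e.2 ≤ pi) ∧ smoothEp j i pj pi e = e) := by
  unfold smoothEp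
  split_ifs with h1 h2
  · exact Or.inl ⟨h1.1, h1.2, rfl⟩
  · exact Or.inr (Or.inl ⟨h2.1, h2.2, rfl⟩)
  · refine Or.inr (Or.inr ⟨fun h => ?_, fun h => ?_, rfl⟩)
    · exact not_lt.1 fun h' => h1 ⟨h, h'⟩
    · exact not_lt.1 fun h' => h2 ⟨h, h'⟩

theorem smoothEp_injective {n : ℕ} {j i : Fin n} (hij : i ≠ j) (pj pi : ℚ) :
    Function.Injective (smoothEp j i pj pi) := by
  rintro ⟨s, x⟩ ⟨s', x'⟩ h
  rcases smoothEp_eq_or j i pj pi (s, x) with ⟨h1, h2, h3⟩ | ⟨h1, h2, h3⟩ | ⟨h1, h2, h3⟩ <;>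
  rcases smoothEp_eq_or j i pj pi (s', x') with ⟨h1', h2', h3'⟩ | ⟨h1', h2', h3'⟩ | ⟨h1', h2', h3'⟩ <;>
  · rw [h3, h3'] at h
    simp only [Prod.mk.injEq] at *
    grind

theorem smoothArrow_injective {n : ℕ} {j i : Fin n} (hij : i ≠ j) (pj pi : ℚ) :
    Function.Injective (smoothArrow j i pj pi) := by
  rintro ⟨ts, tp, hs, hp, s⟩ ⟨ts', tp', hs', hp', s'⟩ h
  simp only [smoothArrow, GArrow.mk.injEq] at h
  obtain ⟨h1, h2, h3, h4, h5⟩ := h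
  have ht := smoothEp_injective hij pj pi (Prod.ext h1 h2)
  have hh := smoothEp_injective hij pj pi (Prod.ext h3 h4)
  simp only [Prod.mk.injEq] at ht hh
  simp [ht, hh, h5]

section Smooth

variable {n : ℕ} {K : Finset (Fin n)} {j i : Fin n} {pj pi : ℚ} {V : Finset (GArrow n)}

theorem smoothArrow_tail (a : GArrow n) (hj : a.tailStr ≠ j) (hi : a.tailStr ≠ i) :
    (smoothArrow j i pj pi a).tailStr = a.tailStr ∧
      (smoothArrow j i pj pi a).tailPos = a.tailPos := by
  simp [smoothArrow, smoothEp_of_ne (e := (a.tailStr, a.tailPos)) hj hi]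

theorem smoothArrow_tail_mem_iff (hjK : j ∉ K) (hiK : i ∉ K) (a : GArrow n) :
    (smoothArrow j i pj pi a).tailStr ∈ K ↔ a.tailStr ∈ K := by
  rcases smoothEp_eq_or j i pj pi (a.tailStr, a.tailPos) with h | h | h
  · have h' : (smoothArrow j i pj pi a).tailStr = i := by simp [smoothArrow, h.2.2]
    rw [h', show a.tailStr = j from h.1]
    exact iff_of_false hiK hjK
  · have h' : (smoothArrow j i pj pi a).tailStr = j := by simp [smoothArrow, h.2.2]
    rw [h', show a.tailStr = i from h.1]
    exact iff_of_false hjK hiK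
  · simp [smoothArrow, h.2.2]

/-- The oriented smoothing maps `V` to a tree diagram with leaves on `K` and trunk on `i` that is
planar; the conditions are expressed in terms of `V`. -/
structure IsSmoothedTree (K : Finset (Fin n)) (j i : Fin n) (pj pi : ℚ)
    (V : Finset (GArrow n)) : Prop where
  ne : ∀ a ∈ V, a.tailStr ≠ a.headStr
  tail_unique : ∀ x ∈ K, ∃! a, a ∈ V ∧ a.tailStr = x
  tail_mem : ∀ a ∈ V, a.tailStr ∈ K
  head_mem : ∀ a ∈ V, a.headStr ∈ K ∨ (a.headStr = i ∧ a.headPos ≤ pi) ∨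
    (a.headStr = j ∧ pj < a.headPos)
  precede : ∀ a ∈ V, ∀ b ∈ V, a.headStr = b.tailStr → a.headPos < b.tailPos
  reach : ∀ x ∈ K, ∃ a ∈ V, (a.headStr = i ∨ a.headStr = j) ∧ Descends V a.tailStr x
  side : ∀ a ∈ V, a.headStr ≠ j → SideCompat V a.headStr a.tailStr
  trunk_side : ∀ a ∈ V, a.headStr = j → SideCompat V i a.tailStr
  order : ∀ a ∈ V, ∀ b ∈ V, a.headStr ≠ j → a.headStr = b.headStr → a.headPos < b.headPos →
    OrderCompat V a.headStr a.tailStr b.tailStr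
  trunk_order : ∀ a ∈ V, ∀ b ∈ V, a.headStr = j → b.headStr = j → a.headPos < b.headPos →
    OrderCompat V i a.tailStr b.tailStr
  trunk_order' : ∀ a ∈ V, ∀ b ∈ V, a.headStr = i → b.headStr = j →
    OrderCompat V i a.tailStr b.tailStr

/-- The possible effects of the smoothing on the head of an arrow of a smoothed tree. -/
theorem smoothArrow_head (hij : i ≠ j) (hjK : j ∉ K) (hiK : i ∉ K) {a : GArrow n}
    (h : a.headStr ∈ K ∨ (a.headStr = i ∧ a.headPos ≤ pi) ∨ (a.headStr = j ∧ pj < a.headPos)) :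
    (a.headStr ∈ K ∧ (smoothArrow j i pj pi a).headStr = a.headStr ∧
      (smoothArrow j i pj pi a).headPos = a.headPos) ∨
    (a.headStr = i ∧ (smoothArrow j i pj pi a).headStr = i ∧
      (smoothArrow j i pj pi a).headPos = a.headPos ∧ a.headPos ≤ pi) ∨
    (a.headStr = j ∧ (smoothArrow j i pj pi a).headStr = i ∧
      (smoothArrow j i pj pi a).headPos = pi + (a.headPos - pj) ∧ pj < a.headPos) := by
  rcases h with h | ⟨h, hp⟩ | ⟨h, hp⟩
  · left
    have h1 : a.headStr ≠ j := fun h' => hjK (h' ▸ h)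
    have h2 : a.headStr ≠ i := fun h' => hiK (h' ▸ h)
    simp [smoothArrow, smoothEp, h1, h2, h]
  · right; left
    simp [smoothArrow, smoothEp, h, hij, hp, not_lt.2 hp]
  · right; right
    simp [smoothArrow, smoothEp, h, hp]

theorem mem_of_smoothArrow_head (hij : i ≠ j) (hjK : j ∉ K) (a : GArrow n)
    (h : (smoothArrow j i pj pi a).headStr ∈ K ∨ (smoothArrow j i pj pi a).headStr = i) :
    a.headStr ∈ K ∨ (a.headStr = i ∧ a.headPos ≤ pi) ∨ (a.headStr = j ∧ pj < a.headPos) := by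
  rcases smoothEp_eq_or j i pj pi (a.headStr, a.headPos) with h' | h' | h'
  · exact Or.inr (Or.inr ⟨h'.1, h'.2.1⟩)
  · have : (smoothArrow j i pj pi a).headStr = j := by simp [smoothArrow, h'.2.2]
    rw [this] at h
    rcases h with h | h
    · exact absurd h hjK
    · exact absurd h.symm hij
  · have : (smoothArrow j i pj pi a).headStr = a.headStr := by simp [smoothArrow, h'.2.2]
    rw [this] at h
    exact h.imp id fun h => Or.inl ⟨h, h'.2.1 h⟩

theorem isPlanarTreeDiagram_image_smoothArrow_iff (hij : i ≠ j) (hjK : j ∉ K) (hiK : i ∉ K) :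
    IsPlanarTreeDiagram K i (V.image (smoothArrow j i pj pi)) ↔
      IsSmoothedTree K j i pj pi V := by
  have key : (∀ a ∈ V, a.tailStr ∈ K) → (∀ a ∈ V, a.headStr ∈ K ∨
      (a.headStr = i ∧ a.headPos ≤ pi) ∨ (a.headStr = j ∧ pj < a.headPos)) →
      (IsPlanarTreeDiagram K i (V.image (smoothArrow j i pj pi)) ↔
      IsSmoothedTree K j i pj pi V) := by
    intro hT hH
    have ht : ∀ a ∈ V, (smoothArrow j i pj pi a).tailStr = a.tailStr ∧
        (smoothArrow j i pj pi a).tailPos = a.tailPos := fun a ha =>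
      smoothArrow_tail a (fun h => hjK (h ▸ hT a ha)) (fun h => hiK (h ▸ hT a ha))
    have hh := fun a ha => smoothArrow_head hij hjK hiK (hH a ha)
    have hpar : ∀ s, s ∈ K → ∀ t, ParentRel (V.image (smoothArrow j i pj pi)) s t ↔
        ParentRel V s t := by
      intro s hs t
      simp only [ParentRel, Finset.exists_mem_image]
      refine exists_congr fun a => and_congr_right fun ha => ?_
      rw [(ht a ha).1]
      refine and_congr_right fun _ => ?_
      rcases hh a ha with h | h | h
      · rw [h.2.1]
      · rw [h.2.1, h.1]
      · rw [h.2.1, h.1]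
        exact ⟨fun h' => absurd (h' ▸ hs) hiK, fun h' => absurd (h' ▸ hs) hjK⟩
    have hd : ∀ s ∈ K, ∀ k, Descends (V.image (smoothArrow j i pj pi)) s k ↔
        Descends V s k := by
      intro s hs k
      refine descends_congr (C := (· ∈ K)) hpar ?_ hs k
      intro s hs t hst
      obtain ⟨a, ha, rfl, -⟩ := (hpar s hs t).1 hst
      exact hT a ha
    have hside : ∀ a ∈ V, ∀ h, SideCompat (V.image (smoothArrow j i pj pi)) h a.tailStr ↔
        SideCompat V h a.tailStr := fun a ha h =>
      forall_congr' fun k => by rw [hd _ (hT a ha)]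
    have horder : ∀ a ∈ V, ∀ b ∈ V, ∀ h,
        OrderCompat (V.image (smoothArrow j i pj pi)) h a.tailStr b.tailStr ↔
        OrderCompat V h a.tailStr b.tailStr := fun a ha b hb h =>
      forall₂_congr fun k k' => by rw [hd _ (hT a ha), hd _ (hT b hb)]
    have hKj : ∀ {x}, x ∈ K → x ≠ j := fun h h' => hjK (h' ▸ h)
    have hKi : ∀ {x}, x ∈ K → x ≠ i := fun h h' => hiK (h' ▸ h)
    rw [isPlanarTreeDiagram_iff]
    simp only [IsTreeDiagram, Finset.forall_mem_image]
    constructor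
    · rintro ⟨⟨h1, h2, h3, h4, h5⟩, hr, hs, ho⟩
      refine ⟨?_, ?_, hT, hH, ?_, ?_, ?_, ?_, ?_, ?_, ?_⟩
      · intro a ha h
        rcases hh a ha with h' | h' | h'
        · exact h1 ha (by rw [(ht a ha).1, h'.2.1, h])
        · exact hKi (hT a ha) (h.trans h'.1)
        · exact hKj (hT a ha) (h.trans h'.1)
      · intro x hx
        obtain ⟨c, ⟨hc, hcx⟩, hu⟩ := h2 x hx
        obtain ⟨a, ha, rfl⟩ := Finset.mem_image.1 hc
        refine ⟨a, ⟨ha, (ht a ha).1 ▸ hcx⟩, fun y hy => smoothArrow_injective hij pj pi ?_⟩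
        exact hu _ ⟨Finset.mem_image_of_mem _ hy.1, (ht y hy.1).1.trans hy.2⟩
      · intro a ha b hb hab
        have := h5 ha hb
        rw [(ht b hb).1, (ht b hb).2] at this
        rcases hh a ha with h' | h' | h'
        · rw [h'.2.1, h'.2.2] at this
          exact this hab
        · exact absurd (hab.symm.trans h'.1) (hKi (hT b hb))
        · exact absurd (hab.symm.trans h'.1) (hKj (hT b hb))
      · intro x hx
        obtain ⟨c, hc, hci, hcx⟩ := hr x hx
        obtain ⟨a, ha, rfl⟩ := Finset.mem_image.1 hc
        rw [(ht a ha).1, hd _ (hT a ha)] at hcx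
        refine ⟨a, ha, ?_, hcx⟩
        rcases hh a ha with h' | h' | h'
        · exact absurd (h'.2.1.symm.trans hci) (hKi h'.1)
        · exact Or.inl h'.1
        · exact Or.inr h'.1
      · intro a ha haj
        have := hs ha
        rw [(ht a ha).1, hside a ha] at this
        rcases hh a ha with h' | h' | h'
        · rwa [h'.2.1] at this
        · rwa [h'.2.1, ← h'.1] at this
        · exact absurd h'.1 haj
      · intro a ha haj
        have := hs ha
        rw [(ht a ha).1, hside a ha] at this
        rcases hh a ha with h' | h' | h'
        · exact absurd haj (hKj h'.1)
        · exact absurd (h'.1.symm.trans haj) hij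
        · rwa [h'.2.1] at this
      · intro a ha b hb haj hab hp
        have := ho ha hb
        rw [(ht a ha).1, (ht b hb).1, horder a ha b hb] at this
        have hbj : b.headStr ≠ j := hab ▸ haj
        rcases hh a ha with h' | h' | h'
        · rcases hh b hb with g | g | g
          · rw [h'.2.1, h'.2.2, g.2.1, g.2.2] at this
            exact this hab hp
          · exact absurd (hab.trans g.1) (hKi h'.1)
          · exact absurd g.1 hbj
        · rcases hh b hb with g | g | g
          · exact absurd (hab.symm.trans h'.1) (hKi g.1)
          · rw [h'.2.1, h'.2.2.1, g.2.1, g.2.2.1] at this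
            rw [h'.1]
            exact this rfl hp
          · exact absurd g.1 hbj
        · exact absurd h'.1 haj
      · intro a ha b hb haj hbj hp
        have := ho ha hb
        rw [(ht a ha).1, (ht b hb).1, horder a ha b hb] at this
        rcases hh a ha with h' | h' | h'
        · exact absurd haj (hKj h'.1)
        · exact absurd (h'.1.symm.trans haj) hij
        · rcases hh b hb with g | g | g
          · exact absurd hbj (hKj g.1)
          · exact absurd (g.1.symm.trans hbj) hij
          · rw [h'.2.1, h'.2.2.1, g.2.1, g.2.2.1] at this
            exact this rfl (by linarith)
      · intro a ha b hb hai hbj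
        have := ho ha hb
        rw [(ht a ha).1, (ht b hb).1, horder a ha b hb] at this
        rcases hh a ha with h' | h' | h'
        · exact absurd hai (hKi h'.1)
        · rcases hh b hb with g | g | g
          · exact absurd hbj (hKj g.1)
          · exact absurd (g.1.symm.trans hbj) hij
          · rw [h'.2.1, h'.2.2.1, g.2.1, g.2.2.1] at this
            exact this rfl (by linarith)
        · exact absurd (hai.symm.trans h'.1) hij
    · intro h
      refine ⟨⟨?_, ?_, ?_, ?_, ?_⟩, ?_, ?_, ?_⟩
      · intro a ha
        rw [(ht a ha).1]
        rcases hh a ha with h' | h' | h'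
        · rw [h'.2.1]; exact h.ne a ha
        · rw [h'.2.1]; exact hKi (hT a ha)
        · rw [h'.2.1]; exact hKi (hT a ha)
      · intro x hx
        obtain ⟨a, ⟨ha, hax⟩, hu⟩ := h.tail_unique x hx
        refine ⟨_, ⟨Finset.mem_image_of_mem _ ha, (ht a ha).1.trans hax⟩, ?_⟩
        rintro y ⟨hy, hyx⟩
        obtain ⟨c, hc, rfl⟩ := Finset.mem_image.1 hy
        rw [hu c ⟨hc, (ht c hc).1 ▸ hyx⟩]
      · intro a ha
        rw [(ht a ha).1]
        exact hT a ha
      · intro a ha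
        rcases hh a ha with h' | h' | h'
        · rw [h'.2.1]; exact Or.inl h'.1
        · exact Or.inr h'.2.1
        · exact Or.inr h'.2.1
      · intro a ha b hb hab
        rw [(ht b hb).1] at hab
        rw [(ht b hb).2]
        rcases hh a ha with h' | h' | h'
        · rw [h'.2.2]
          exact h.precede a ha b hb (h'.2.1 ▸ hab)
        · exact absurd (hab.symm.trans h'.2.1) (hKi (hT b hb))
        · exact absurd (hab.symm.trans h'.2.1) (hKi (hT b hb))
      · intro x hx
        obtain ⟨a, ha, hai, hax⟩ := h.reach x hx
        refine ⟨_, Finset.mem_image_of_mem _ ha, ?_, ?_⟩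
        · rcases hh a ha with h' | h' | h'
          · exact (hai.elim (hKi h'.1) (hKj h'.1)).elim
          · exact h'.2.1
          · exact h'.2.1
        · rw [(ht a ha).1, hd _ (hT a ha)]
          exact hax
      · intro a ha
        rw [(ht a ha).1, hside a ha]
        rcases hh a ha with h' | h' | h'
        · rw [h'.2.1]; exact h.side a ha (hKj h'.1)
        · rw [h'.2.1]; exact h'.1 ▸ h.side a ha (h'.1 ▸ hij)
        · rw [h'.2.1]; exact h.trunk_side a ha h'.1
      · intro a ha b hb
        rw [(ht a ha).1, (ht b hb).1, horder a ha b hb]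
        rcases hh a ha with h' | h' | h'
        · rcases hh b hb with g | g | g
          · rw [h'.2.1, h'.2.2, g.2.1, g.2.2]
            exact h.order a ha b hb (hKj h'.1)
          · rw [h'.2.1, g.2.1]
            exact fun hab => absurd hab (hKi h'.1)
          · rw [h'.2.1, g.2.1]
            exact fun hab => absurd hab (hKi h'.1)
        · rcases hh b hb with g | g | g
          · rw [h'.2.1, g.2.1]
            exact fun hab => absurd hab.symm (hKi g.1)
          · rw [h'.2.1, h'.2.2.1, g.2.1, g.2.2.1]
            intro _ hp
            have := h.order a ha b hb (h'.1 ▸ hij) (h'.1.trans g.1.symm) hp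
            rwa [h'.1] at this
          · rw [h'.2.1]
            exact fun _ _ => h.trunk_order' a ha b hb h'.1 g.1
        · rcases hh b hb with g | g | g
          · rw [h'.2.1, g.2.1]
            exact fun hab => absurd hab.symm (hKi g.1)
          · rw [h'.2.2.1, g.2.2.1]
            intro _ hp
            linarith
          · rw [h'.2.1, h'.2.2.1, g.2.2.1]
            exact fun _ hp => h.trunk_order a ha b hb h'.1 g.1 (by linarith)
  constructor
  · intro h
    refine (key ?_ ?_).1 h
    · exact fun a ha => (smoothArrow_tail_mem_iff hjK hiK a).1
        (h.1.2.2.1 _ (Finset.mem_image_of_mem _ ha))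
    · exact fun a ha => mem_of_smoothArrow_head hij hjK a
        (h.1.2.2.2.1 _ (Finset.mem_image_of_mem _ ha))
  · exact fun h => (key h.tail_mem h.head_mem).2 h

end Smooth

section Split

variable {n : ℕ} {I : Finset (Fin n)} {j i c : Fin n} {pj pi : ℚ} {U : Finset (GArrow n)}

/-- If no arrow of `U` away from the strings `i` and `j` crosses the cut `c`, then the subtrees
lie on one side of the cut, and are determined by the arrows with tails on that side. -/
theorem descends_filter_iff (hj : ∀ a ∈ U, a.tailStr ≠ j) (hi : ∀ a ∈ U, a.tailStr ≠ i)
    (hU : ∀ a ∈ U, a.headStr ≠ i → a.headStr ≠ j → (a.headStr < c ↔ a.tailStr < c))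
    {a : GArrow n} (ha : a ∈ U) :
    (∀ k, Descends U a.tailStr k → (k < c ↔ a.tailStr < c)) ∧
    (a.tailStr < c → ∀ k, Descends (U.filter (·.tailStr < c)) a.tailStr k ↔
      Descends U a.tailStr k) ∧
    (¬ a.tailStr < c → ∀ k, Descends (U.filter (¬ ·.tailStr < c)) a.tailStr k ↔
      Descends U a.tailStr k) := by
  have hcl : ∀ s, (s ≠ i ∧ s ≠ j ∧ (s < c ↔ a.tailStr < c)) → ∀ t, ParentRel U s t →
      t ≠ i ∧ t ≠ j ∧ (t < c ↔ a.tailStr < c) := by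
    rintro _ ⟨h1, h2, h3⟩ _ ⟨b, hb, rfl, rfl⟩
    exact ⟨hi b hb, hj b hb, (hU b hb h1 h2).symm.trans h3⟩
  have h0 : a.tailStr ≠ i ∧ a.tailStr ≠ j ∧ (a.tailStr < c ↔ a.tailStr < c) :=
    ⟨hi a ha, hj a ha, Iff.rfl⟩
  refine ⟨fun k hk => (hk.closed hcl h0).2.2, fun hac k => Iff.symm ?_, fun hac k => Iff.symm ?_⟩
  · refine descends_congr ?_ hcl h0 k
    intro s hs t
    refine exists_congr fun b => ⟨?_, fun h => ⟨(Finset.mem_filter.1 h.1).1, h.2⟩⟩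
    rintro ⟨hb, rfl, h⟩
    exact ⟨Finset.mem_filter.2 ⟨hb, (hcl s hs _ ⟨b, hb, rfl, h⟩).2.2.2 hac⟩, rfl, h⟩
  · refine descends_congr ?_ hcl h0 k
    intro s hs t
    refine exists_congr fun b => ⟨?_, fun h => ⟨(Finset.mem_filter.1 h.1).1, h.2⟩⟩
    rintro ⟨hb, rfl, h⟩
    exact ⟨Finset.mem_filter.2 ⟨hb, fun h' => hac ((hcl s hs _ ⟨b, hb, rfl, h⟩).2.2.1 h')⟩,
      rfl, h⟩

theorem isPlanar_split_iff (hjI : ∀ x ∈ I, j < x) (hi : i ∈ I) (hci : c ≤ i)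
    (hpi : ∀ a ∈ U, a.headStr = i → a.headPos ≠ pi) :
    IsPlanarTreeDiagram (I.filter (· < c)) j (U.filter (·.tailStr < c)) ∧
      IsSmoothedTree ((I.filter (c ≤ ·)).erase i) j i pj pi (U.filter (¬ ·.tailStr < c)) ↔
    IsTwoRootedForest I j i pi U ∧
      CutValid (U.filter (·.headStr = j)) (·.tailStr) (·.headPos)
        (fun a => Descends U a.tailStr) (Descends U i) i pj c := by
  have hij : i ≠ j := (hjI i hi).ne'
  rw [isPlanarTreeDiagram_iff]
  constructor
  · rintro ⟨⟨⟨t1, t2, t3, t4, t5⟩, tr, ts, tord⟩, hV⟩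
    have m1 : ∀ a ∈ U, a.tailStr < c → a ∈ U.filter (·.tailStr < c) := fun a ha h =>
      Finset.mem_filter.2 ⟨ha, h⟩
    have m2 : ∀ a ∈ U, ¬ a.tailStr < c → a ∈ U.filter (¬ ·.tailStr < c) := fun a ha h =>
      Finset.mem_filter.2 ⟨ha, h⟩
    have hT : ∀ a ∈ U, a.tailStr ∈ I ∧ a.tailStr ≠ i := by
      intro a ha
      by_cases h : a.tailStr < c
      · exact ⟨(Finset.mem_filter.1 (t3 a (m1 a ha h))).1, (h.trans_le hci).ne⟩
      · have := hV.tail_mem a (m2 a ha h)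
        simp only [Finset.mem_erase, Finset.mem_filter] at this
        exact ⟨this.2.1, this.1⟩
    have hTj : ∀ a ∈ U, a.tailStr ≠ j := fun a ha => (hjI _ (hT a ha).1).ne'
    have h1 : ∀ a ∈ U, a.tailStr < c → (a.headStr ∈ I ∧ a.headStr < c) ∨ a.headStr = j :=
      fun a ha h => (t4 a (m1 a ha h)).imp (fun h => Finset.mem_filter.1 h) id
    have h2 : ∀ a ∈ U, ¬ a.tailStr < c → (a.headStr ∈ I ∧ a.headStr ≠ i ∧ ¬ a.headStr < c) ∨
        (a.headStr = i ∧ a.headPos ≤ pi) ∨ (a.headStr = j ∧ pj < a.headPos) := by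
      intro a ha h
      refine (hV.head_mem a (m2 a ha h)).imp (fun h => ?_) id
      simp only [Finset.mem_erase, Finset.mem_filter] at h
      exact ⟨h.2.1, h.1, not_lt.2 h.2.2⟩
    have hI2 : ∀ a ∈ U, a.headStr = i → ¬ a.tailStr < c := by
      intro a ha hai h
      rcases h1 a ha h with h' | h'
      · exact absurd (hai ▸ h'.2) (not_lt.2 hci)
      · exact hij (hai.symm.trans h')
    have hsplit : ∀ a ∈ U, a.headStr ≠ i → a.headStr ≠ j →
        (a.headStr < c ↔ a.tailStr < c) := by
      intro a ha hai haj
      by_cases h : a.tailStr < c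
      · rcases h1 a ha h with h' | h'
        · exact iff_of_true h'.2 h
        · exact absurd h' haj
      · rcases h2 a ha h with h' | h' | h'
        · exact iff_of_false h'.2.2 h
        · exact absurd h'.1 hai
        · exact absurd h'.1 haj
    have hd := fun a ha =>
      descends_filter_iff hTj (fun a ha => (hT a ha).2) hsplit (a := a) ha
    have mJ : ∀ a ∈ U, a ∈ U.filter (·.headStr = j) ↔ a.headStr = j := fun a ha => by
      simp [ha]
    have side1 : ∀ a ∈ U, a.tailStr < c → SideCompat U a.headStr a.tailStr :=
      fun a ha h k hk => ts a (m1 a ha h) k (((hd a ha).2.1 h k).2 hk)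
    have order2 : ∀ h, ∀ a ∈ U, ∀ b ∈ U, ¬ a.tailStr < c → ¬ b.tailStr < c →
        OrderCompat (U.filter (¬ ·.tailStr < c)) h a.tailStr b.tailStr →
        OrderCompat U h a.tailStr b.tailStr :=
      fun h a ha b hb hac hbc ho k k' hk hk' =>
        ho k k' (((hd a ha).2.2 hac k).2 hk) (((hd b hb).2.2 hbc k').2 hk')
    have sideT : ∀ a ∈ U, a.headStr = j → ¬ a.tailStr < c → SideCompat U i a.tailStr :=
      fun a ha haj h k hk => hV.trunk_side a (m2 a ha h) haj k (((hd a ha).2.2 h k).2 hk)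
    have sideI : ∀ a ∈ U, a.headStr = i → SideCompat U i a.tailStr := by
      intro a ha hai k hk
      have := hV.side a (m2 a ha (hI2 a ha hai)) (hai ▸ hij) k
        (((hd a ha).2.2 (hI2 a ha hai) k).2 hk)
      rwa [hai] at this
    refine ⟨⟨?_, ?_, fun a ha => (hT a ha).1, fun a ha => (hT a ha).2, ?_, ?_, ?_, ?_, ?_, ?_⟩, ?_⟩
    · intro a ha
      by_cases h : a.tailStr < c
      · exact t1 a (m1 a ha h)
      · exact hV.ne a (m2 a ha h)
    · intro x hx hxi
      by_cases h : x < c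
      · obtain ⟨a, ⟨ha, hax⟩, hu⟩ := t2 x (Finset.mem_filter.2 ⟨hx, h⟩)
        exact ⟨a, ⟨(Finset.mem_filter.1 ha).1, hax⟩,
          fun y hy => hu y ⟨m1 y hy.1 (hy.2.symm ▸ h), hy.2⟩⟩
      · obtain ⟨a, ⟨ha, hax⟩, hu⟩ := hV.tail_unique x
          (Finset.mem_erase.2 ⟨hxi, Finset.mem_filter.2 ⟨hx, not_lt.1 h⟩⟩)
        exact ⟨a, ⟨(Finset.mem_filter.1 ha).1, hax⟩,
          fun y hy => hu y ⟨m2 y hy.1 (hy.2.symm ▸ h), hy.2⟩⟩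
    · intro a ha
      by_cases h : a.tailStr < c
      · exact (h1 a ha h).imp And.left id
      · rcases h2 a ha h with h' | h' | h'
        · exact Or.inl h'.1
        · exact Or.inl (h'.1 ▸ hi)
        · exact Or.inr h'.1
    · intro a ha b hb hab
      have hai : a.headStr ≠ i := hab ▸ (hT b hb).2
      have haj : a.headStr ≠ j := hab ▸ hTj b hb
      have hs := hsplit a ha hai haj
      rw [hab] at hs
      by_cases h : a.tailStr < c
      · exact t5 a (m1 a ha h) b (m1 b hb (hs.2 h)) hab
      · exact hV.precede a (m2 a ha h) b (m2 b hb (mt hs.1 h)) hab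
    · intro a ha hai
      rcases h2 a ha (hI2 a ha hai) with h' | h' | h'
      · exact absurd hai h'.2.1
      · exact lt_of_le_of_ne h'.2 (hpi a ha hai)
      · exact absurd (hai.symm.trans h'.1) hij
    · intro x hx hxi
      by_cases h : x < c
      · obtain ⟨a, ha, haj, hax⟩ := tr x (Finset.mem_filter.2 ⟨hx, h⟩)
        obtain ⟨ha, hac⟩ := Finset.mem_filter.1 ha
        exact ⟨a, ha, Or.inr haj, ((hd a ha).2.1 hac x).1 hax⟩
      · obtain ⟨a, ha, haj, hax⟩ := hV.reach x
          (Finset.mem_erase.2 ⟨hxi, Finset.mem_filter.2 ⟨hx, not_lt.1 h⟩⟩)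
        obtain ⟨ha, hac⟩ := Finset.mem_filter.1 ha
        exact ⟨a, ha, haj, ((hd a ha).2.2 hac x).1 hax⟩
    · intro a ha haj
      by_cases h : a.tailStr < c
      · exact side1 a ha h
      · exact fun k hk => hV.side a (m2 a ha h) haj k (((hd a ha).2.2 h k).2 hk)
    · intro a ha b hb haj hab hp
      by_cases h : a.tailStr < c
      · have hai : a.headStr ≠ i := fun h' => hI2 a ha h' h
        have hbc : b.tailStr < c := by
          rw [← hsplit b hb (hab ▸ hai) (hab ▸ haj), ← hab, hsplit a ha hai haj]
          exact h
        exact fun k k' hk hk' => tord a (m1 a ha h) b (m1 b hb hbc) hab hp k k'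
          (((hd a ha).2.1 h k).2 hk) (((hd b hb).2.1 hbc k').2 hk')
      · have hbc : ¬ b.tailStr < c := by
          by_cases hai : a.headStr = i
          · exact hI2 b hb (hab.symm.trans hai)
          · rw [← hsplit b hb (hab ▸ hai) (hab ▸ haj), ← hab, hsplit a ha hai haj]
            exact h
        exact order2 _ a ha b hb h hbc (hV.order a (m2 a ha h) b (m2 b hb hbc) haj hab hp)
    · constructor
      · intro a ha hac k hk
        exact ((hd a (Finset.mem_filter.1 ha).1).1 k hk).2 hac
      · intro a ha hac k hk
        exact not_lt.1 (mt ((hd a (Finset.mem_filter.1 ha).1).1 k hk).1 (not_lt.2 hac))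
      · intro x hx
        rcases descends_iff.1 hx with rfl | ⟨a, ha, hai, hax⟩
        · exact hci
        · exact not_lt.1 (mt ((hd a ha).1 x hax).1 (hI2 a ha hai))
      · intro a ha b hb hac hbc hp k k' hk hk'
        obtain ⟨ha, haj⟩ := Finset.mem_filter.1 ha
        obtain ⟨hb, hbj⟩ := Finset.mem_filter.1 hb
        refine (tord a (m1 a ha hac) b (m1 b hb hbc) (haj.trans hbj.symm) hp k k'
          (((hd a ha).2.1 hac k).2 hk) (((hd b hb).2.1 hbc k').2 hk')).2 ?_ ?_
        · exact haj ▸ hjI _ (hT a ha).1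
        · exact haj ▸ hjI _ (hT b hb).1
      · intro a ha hac
        obtain ⟨ha, haj⟩ := Finset.mem_filter.1 ha
        rcases h2 a ha (not_lt.2 hac) with h' | h' | h'
        · exact absurd haj (hjI _ h'.1).ne'
        · exact absurd (h'.1.symm.trans haj) hij
        · exact h'.2
      · intro a ha hac
        obtain ⟨ha, haj⟩ := Finset.mem_filter.1 ha
        exact sideT a ha haj (not_lt.2 hac)
      · intro a ha b hb hac hbc hp hai hbi k k' hk hk'
        obtain ⟨ha, haj⟩ := Finset.mem_filter.1 ha
        obtain ⟨hb, hbj⟩ := Finset.mem_filter.1 hb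
        exact (order2 _ a ha b hb (not_lt.2 hac) (not_lt.2 hbc)
          (hV.trunk_order a (m2 a ha (not_lt.2 hac)) b (m2 b hb (not_lt.2 hbc)) haj hbj hp)
          k k' hk hk').1 hai hbi
      · intro a ha b hb hac hbc hp hai hbi k k' hk hk'
        obtain ⟨ha, haj⟩ := Finset.mem_filter.1 ha
        obtain ⟨hb, hbj⟩ := Finset.mem_filter.1 hb
        exact (order2 _ a ha b hb (not_lt.2 hac) (not_lt.2 hbc)
          (hV.trunk_order a (m2 a ha (not_lt.2 hac)) b (m2 b hb (not_lt.2 hbc)) haj hbj hp)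
          k k' hk hk').2 hai hbi
      · intro b hb hbc hbi k x hk hx
        obtain ⟨hb, hbj⟩ := Finset.mem_filter.1 hb
        have hki : k < i := (sideT b hb hbj (not_lt.2 hbc) k hk).1 hbi
        rcases descends_iff.1 hx with rfl | ⟨a, ha, hai, hax⟩
        · exact hki
        · rcases lt_or_gt_of_ne (hT a ha).2 with h | h
          · exact (order2 _ a ha b hb (hI2 a ha hai) (not_lt.2 hbc)
              (hV.trunk_order' a (m2 a ha (hI2 a ha hai)) b (m2 b hb (not_lt.2 hbc)) hai hbj)
              x k hax hk).1 h hbi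
          · exact hki.trans_le (not_lt.1 (mt (sideI a ha hai x hax).2 h.not_gt))
      · intro b hb hbc hbi k x hk hx
        obtain ⟨hb, hbj⟩ := Finset.mem_filter.1 hb
        have hki : i < k := by
          refine lt_of_le_of_ne (not_lt.1 (mt (sideT b hb hbj (not_lt.2 hbc) k hk).2 hbi.not_gt)) ?_
          rintro rfl
          have := (hk.closed (C := (· ≠ i)) ?_ (hT b hb).2)
          · exact this rfl
          · rintro s _ _ ⟨a, ha, rfl, -⟩
            exact (hT a ha).2
        rcases descends_iff.1 hx with rfl | ⟨a, ha, hai, hax⟩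
        · exact hki
        · rcases lt_or_gt_of_ne (hT a ha).2 with h | h
          · exact ((sideI a ha hai x hax).1 h).trans hki
          · exact (order2 _ a ha b hb (hI2 a ha hai) (not_lt.2 hbc)
              (hV.trunk_order' a (m2 a ha (hI2 a ha hai)) b (m2 b hb (not_lt.2 hbc)) hai hbj)
              x k hax hk).2 h hbi
  · rintro ⟨hF, hC⟩
    have hTj : ∀ a ∈ U, a.tailStr ≠ j := fun a ha => (hjI _ (hF.tail_mem a ha)).ne'
    have hI2 : ∀ a ∈ U, a.headStr = i → ∀ k, Descends U a.tailStr k → ¬ k < c :=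
      fun a ha hai k hk => not_lt.2 (hC.root k (descends_iff.2 (Or.inr ⟨a, ha, hai, hk⟩)))
    have hJ : ∀ a ∈ U, a.headStr = j → ∀ k, Descends U a.tailStr k →
        (k < c ↔ a.tailStr < c) := by
      intro a ha haj k hk
      have haA : a ∈ U.filter (·.headStr = j) := Finset.mem_filter.2 ⟨ha, haj⟩
      refine ⟨fun h => ?_, fun h => hC.low a haA h k hk⟩
      by_contra h'
      exact absurd (hC.high a haA (not_lt.1 h') k hk) (not_le.2 h)
    have hsplit : ∀ a ∈ U, a.headStr ≠ i → a.headStr ≠ j →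
        (a.headStr < c ↔ a.tailStr < c) := by
      intro a ha hai haj
      obtain ⟨r, hr, hrr, hrd⟩ := hF.reach a.headStr ((hF.head_mem a ha).resolve_right haj) hai
      have hrt : Descends U r.tailStr a.tailStr := hrd.tail ⟨a, ha, rfl, rfl⟩
      rcases hrr with h | h
      · exact iff_of_false (hI2 r hr h _ hrd) (hI2 r hr h _ hrt)
      · exact (hJ r hr h _ hrd).trans (hJ r hr h _ hrt).symm
    have hd := fun a ha => descends_filter_iff hTj hF.tail_ne hsplit (a := a) ha
    have hIt : ∀ a ∈ U, a.headStr = i → ¬ a.tailStr < c := fun a ha hai =>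
      hI2 a ha hai _ .refl
    refine ⟨⟨⟨?_, ?_, ?_, ?_, ?_⟩, ?_, ?_, ?_⟩, ⟨?_, ?_, ?_, ?_, ?_, ?_, ?_, ?_, ?_, ?_, ?_⟩⟩
    · exact fun a ha => hF.ne a (Finset.mem_filter.1 ha).1
    · intro x hx
      obtain ⟨hx, hxc⟩ := Finset.mem_filter.1 hx
      obtain ⟨a, ⟨ha, hax⟩, hu⟩ := hF.tail_unique x hx (hxc.trans_le hci).ne
      exact ⟨a, ⟨Finset.mem_filter.2 ⟨ha, hax.symm ▸ hxc⟩, hax⟩,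
        fun y hy => hu y ⟨(Finset.mem_filter.1 hy.1).1, hy.2⟩⟩
    · intro a ha
      obtain ⟨ha, hac⟩ := Finset.mem_filter.1 ha
      exact Finset.mem_filter.2 ⟨hF.tail_mem a ha, hac⟩
    · intro a ha
      obtain ⟨ha, hac⟩ := Finset.mem_filter.1 ha
      refine or_iff_not_imp_right.2 fun haj => Finset.mem_filter.2
        ⟨(hF.head_mem a ha).resolve_right haj, ?_⟩
      exact (hsplit a ha (fun h => hIt a ha h hac) haj).2 hac
    · exact fun a ha b hb => hF.precede a (Finset.mem_filter.1 ha).1 b (Finset.mem_filter.1 hb).1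
    · intro x hx
      obtain ⟨hx, hxc⟩ := Finset.mem_filter.1 hx
      obtain ⟨a, ha, h, hax⟩ := hF.reach x hx (hxc.trans_le hci).ne
      have hac := ((hd a ha).1 x hax).1 hxc
      exact ⟨a, Finset.mem_filter.2 ⟨ha, hac⟩, h.resolve_left fun h => hIt a ha h hac,
        ((hd a ha).2.1 hac x).2 hax⟩
    · intro a ha k hk
      obtain ⟨ha, hac⟩ := Finset.mem_filter.1 ha
      replace hk := ((hd a ha).2.1 hac k).1 hk
      by_cases haj : a.headStr = j
      · rw [haj]
        exact iff_of_false (hjI _ (hF.tail_mem a ha)).not_gt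
          (hjI _ (hk.mem hF.tail_mem (hF.tail_mem a ha))).not_gt
      · exact hF.side a ha haj k hk
    · intro a ha b hb hab hp k k' hk hk'
      obtain ⟨ha, hac⟩ := Finset.mem_filter.1 ha
      obtain ⟨hb, hbc⟩ := Finset.mem_filter.1 hb
      replace hk := ((hd a ha).2.1 hac k).1 hk
      replace hk' := ((hd b hb).2.1 hbc k').1 hk'
      by_cases haj : a.headStr = j
      · refine ⟨fun h => absurd (haj ▸ h) (hjI _ (hF.tail_mem a ha)).not_gt, fun _ _ => ?_⟩
        exact hC.low_order a (Finset.mem_filter.2 ⟨ha, haj⟩) b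
          (Finset.mem_filter.2 ⟨hb, hab.symm.trans haj⟩) hac hbc hp k k' hk hk'
      · exact hF.order a ha b hb haj hab hp k k' hk hk'
    · exact fun a ha => hF.ne a (Finset.mem_filter.1 ha).1
    · intro x hx
      obtain ⟨hxi, hx⟩ := Finset.mem_erase.1 hx
      obtain ⟨hx, hxc⟩ := Finset.mem_filter.1 hx
      obtain ⟨a, ⟨ha, hax⟩, hu⟩ := hF.tail_unique x hx hxi
      exact ⟨a, ⟨Finset.mem_filter.2 ⟨ha, hax.symm ▸ not_lt.2 hxc⟩, hax⟩,
        fun y hy => hu y ⟨(Finset.mem_filter.1 hy.1).1, hy.2⟩⟩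
    · intro a ha
      obtain ⟨ha, hac⟩ := Finset.mem_filter.1 ha
      exact Finset.mem_erase.2 ⟨hF.tail_ne a ha,
        Finset.mem_filter.2 ⟨hF.tail_mem a ha, not_lt.1 hac⟩⟩
    · intro a ha
      obtain ⟨ha, hac⟩ := Finset.mem_filter.1 ha
      by_cases hai : a.headStr = i
      · exact Or.inr (Or.inl ⟨hai, (hF.head_pos a ha hai).le⟩)
      by_cases haj : a.headStr = j
      · exact Or.inr (Or.inr ⟨haj, hC.pos a (Finset.mem_filter.2 ⟨ha, haj⟩) (not_lt.1 hac)⟩)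
      · exact Or.inl (Finset.mem_erase.2 ⟨hai, Finset.mem_filter.2
          ⟨(hF.head_mem a ha).resolve_right haj, not_lt.1 (mt (hsplit a ha hai haj).1 hac)⟩⟩)
    · exact fun a ha b hb => hF.precede a (Finset.mem_filter.1 ha).1 b (Finset.mem_filter.1 hb).1
    · intro x hx
      obtain ⟨hxi, hx⟩ := Finset.mem_erase.1 hx
      obtain ⟨hx, hxc⟩ := Finset.mem_filter.1 hx
      obtain ⟨a, ha, h, hax⟩ := hF.reach x hx hxi
      have hac := mt ((hd a ha).1 x hax).2 (not_lt.2 hxc)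
      exact ⟨a, Finset.mem_filter.2 ⟨ha, hac⟩, h, ((hd a ha).2.2 hac x).2 hax⟩
    · intro a ha haj k hk
      obtain ⟨ha, hac⟩ := Finset.mem_filter.1 ha
      exact hF.side a ha haj k (((hd a ha).2.2 hac k).1 hk)
    · intro a ha haj k hk
      obtain ⟨ha, hac⟩ := Finset.mem_filter.1 ha
      exact hC.side a (Finset.mem_filter.2 ⟨ha, haj⟩) (not_lt.1 hac) k
        (((hd a ha).2.2 hac k).1 hk)
    · intro a ha b hb haj hab hp k k' hk hk'
      obtain ⟨ha, hac⟩ := Finset.mem_filter.1 ha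
      obtain ⟨hb, hbc⟩ := Finset.mem_filter.1 hb
      exact hF.order a ha b hb haj hab hp k k' (((hd a ha).2.2 hac k).1 hk)
        (((hd b hb).2.2 hbc k').1 hk')
    · intro a ha b hb haj hbj hp k k' hk hk'
      obtain ⟨ha, hac⟩ := Finset.mem_filter.1 ha
      obtain ⟨hb, hbc⟩ := Finset.mem_filter.1 hb
      replace hk := ((hd a ha).2.2 hac k).1 hk
      replace hk' := ((hd b hb).2.2 hbc k').1 hk'
      have haA : a ∈ U.filter (·.headStr = j) := Finset.mem_filter.2 ⟨ha, haj⟩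
      have hbA : b ∈ U.filter (·.headStr = j) := Finset.mem_filter.2 ⟨hb, hbj⟩
      exact ⟨fun h h' => hC.high_left a haA b hbA (not_lt.1 hac) (not_lt.1 hbc) hp h h' k k' hk hk',
        fun h h' => hC.high_right a haA b hbA (not_lt.1 hac) (not_lt.1 hbc) hp h h' k k' hk hk'⟩
    · intro a ha b hb hai hbj k k' hk hk'
      obtain ⟨ha, hac⟩ := Finset.mem_filter.1 ha
      obtain ⟨hb, hbc⟩ := Finset.mem_filter.1 hb
      replace hk := ((hd a ha).2.2 hac k).1 hk
      replace hk' := ((hd b hb).2.2 hbc k').1 hk'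
      have hE : Descends U i k := descends_iff.2 (Or.inr ⟨a, ha, hai, hk⟩)
      have hbA : b ∈ U.filter (·.headStr = j) := Finset.mem_filter.2 ⟨hb, hbj⟩
      exact ⟨fun _ h' => hC.root_left b hbA (not_lt.1 hbc) h' k' k hk' hE,
        fun _ h' => hC.root_right b hbA (not_lt.1 hbc) h' k' k hk' hE⟩

end Split

theorem sum_powerset_mul_sum_powerset {α R : Type*} [CommSemiring R] (P : Finset α)
    (p : α → Prop) [DecidablePred p] (F G : Finset α → R) (hF : ∀ T ⊆ P, F T ≠ 0 → ∀ a ∈ T, p a)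
    (hG : ∀ T ⊆ P, G T ≠ 0 → ∀ a ∈ T, ¬ p a) :
    (∑ T ∈ P.powerset, F T) * ∑ T ∈ P.powerset, G T
      = ∑ U ∈ P.powerset, F (U.filter p) * G (U.filter (¬ p ·)) := by
  rw [Finset.sum_mul_sum, ← Finset.sum_product']
  symm
  refine Finset.sum_of_injOn (fun U => (U.filter p, U.filter (¬ p ·))) ?_ ?_ ?_ ?_
  · intro U _ U' _ h
    rw [← Finset.filter_union_filter_not_eq p U, ← Finset.filter_union_filter_not_eq p U']
    exact congrArg₂ (· ∪ ·) (Prod.ext_iff.1 h).1 (Prod.ext_iff.1 h).2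
  · intro U hU
    have hU' := Finset.mem_powerset.1 hU
    exact Finset.mem_product.2 ⟨Finset.mem_powerset.2 ((Finset.filter_subset _ _).trans hU'),
      Finset.mem_powerset.2 ((Finset.filter_subset _ _).trans hU')⟩
  · rintro ⟨T, V⟩ hTV hn
    obtain ⟨hT, hV⟩ := Finset.mem_product.1 hTV
    replace hT := Finset.mem_powerset.1 hT
    replace hV := Finset.mem_powerset.1 hV
    by_contra h0
    have hpT := hF T hT (left_ne_zero_of_mul h0)
    have hpV := hG V hV (right_ne_zero_of_mul h0)
    refine hn ⟨T ∪ V, Finset.mem_powerset.2 (Finset.union_subset hT hV), ?_⟩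
    refine Prod.ext ?_ ?_
    · show (T ∪ V).filter p = T
      rw [Finset.filter_union, Finset.filter_true_of_mem hpT, Finset.filter_false_of_mem hpV,
        Finset.union_empty]
    · show (T ∪ V).filter (¬ p ·) = V
      rw [Finset.filter_union, Finset.filter_true_of_mem hpV,
        Finset.filter_false_of_mem fun a ha => not_not.2 (hpT a ha), Finset.empty_union]
  · exact fun _ _ => rfl

section Skein

variable {n : ℕ}

/-- The contribution of an arrow to the signed count of tree diagrams. -/
noncomputable def arrowWeight (a : GArrow n) : ℤ :=
  (if a.tailStr < a.headStr then -1 else 1) * a.sign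

/-- The contribution of a set of arrows to the signed count of planar tree diagrams. -/
noncomputable def treeTerm (I : Finset (Fin n)) (j : Fin n) (S : Finset (GArrow n)) : ℤ :=
  if IsPlanarTreeDiagram I j S then ∏ a ∈ S, arrowWeight a else 0

theorem Z_eq_sum_treeTerm (I : Finset (Fin n)) (j : Fin n) (G : GaussDiagram n) :
    Z I j G = ∑ S ∈ G.arrows.powerset, treeTerm I j S := by
  refine Finset.sum_congr rfl fun S _ => ?_
  simp only [treeTerm, arrowWeight, treeSign, Finset.prod_mul_distrib, Finset.prod_ite,
    Finset.prod_const, one_pow, mul_one]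

theorem treeTerm_eq_zero_of_tail {I : Finset (Fin n)} {j : Fin n} {S : Finset (GArrow n)}
    {a : GArrow n} (ha : a ∈ S) (h : a.tailStr ∉ I) : treeTerm I j S = 0 :=
  if_neg fun hS => h (hS.1.2.2.1 a ha)

theorem Z_eq_of_arrows_eq_insert {I : Finset (Fin n)} {j : Fin n} {G : GaussDiagram n}
    {a : GArrow n} {P : Finset (GArrow n)} (hG : G.arrows = insert a P) (ha : a ∉ P) :
    Z I j G = ∑ U ∈ P.powerset, treeTerm I j U
      + ∑ U ∈ P.powerset, treeTerm I j (insert a U) := by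
  rw [Z_eq_sum_treeTerm, hG, Finset.sum_powerset_insert ha]

theorem Z_eq_of_tail_notMem {I : Finset (Fin n)} {j : Fin n} {G : GaussDiagram n}
    {a : GArrow n} {P : Finset (GArrow n)} (hG : G.arrows = insert a P) (ha : a ∉ P)
    (haI : a.tailStr ∉ I) : Z I j G = ∑ U ∈ P.powerset, treeTerm I j U := by
  rw [Z_eq_of_arrows_eq_insert hG ha, Finset.sum_eq_zero (s := P.powerset)
    (f := fun U => treeTerm I j (insert a U)), add_zero]
  exact fun U _ => treeTerm_eq_zero_of_tail (Finset.mem_insert_self a U) haI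

theorem Z_eq_of_arrows_eq_image {K : Finset (Fin n)} {j i : Fin n} (hij : i ≠ j) {pj pi : ℚ}
    {G : GaussDiagram n} {P : Finset (GArrow n)}
    (hG : G.arrows = P.image (smoothArrow j i pj pi)) :
    Z K i G = ∑ V ∈ P.powerset, treeTerm K i (V.image (smoothArrow j i pj pi)) := by
  rw [Z_eq_sum_treeTerm, hG, Finset.powerset_image, Finset.sum_image]
  exact (Finset.image_injective (smoothArrow_injective hij pj pi)).injOn

theorem prod_arrowWeight_image {K : Finset (Fin n)} {j i : Fin n} {pj pi : ℚ}
    {V : Finset (GArrow n)} (hij : i ≠ j) (hjK : ∀ x ∈ K, j < x) (hiK : i ∉ K)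
    (hV : IsSmoothedTree K j i pj pi V) :
    ∏ a ∈ V.image (smoothArrow j i pj pi), arrowWeight a
      = (∏ a ∈ V, arrowWeight a) *
        (-1) ^ (V.filter fun a => a.headStr = j ∧ a.tailStr < i).card := by
  rw [Finset.prod_image (smoothArrow_injective hij pj pi).injOn, ← Finset.prod_const,
    Finset.prod_filter, ← Finset.prod_mul_distrib]
  refine Finset.prod_congr rfl fun a ha => ?_
  have haK := hV.tail_mem a ha
  have hjK' : j ∉ K := fun h => lt_irrefl _ (hjK j h)
  have hti : a.tailStr ≠ i := fun h => hiK (h ▸ haK)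
  have ht : (smoothArrow j i pj pi a).tailStr = a.tailStr :=
    (smoothArrow_tail a (hjK _ haK).ne' hti).1
  have hs : (smoothArrow j i pj pi a).sign = a.sign := rfl
  rw [arrowWeight, arrowWeight, ht, hs]
  rcases smoothArrow_head hij hjK' hiK (hV.head_mem a ha) with ⟨h, h', -⟩ | ⟨h, h', -⟩ | ⟨h, h', -⟩
  · rw [h', if_neg fun h'' : a.headStr = j ∧ _ => hjK' (h''.1 ▸ h), mul_one]
  · rw [h', h, if_neg fun h'' : i = j ∧ _ => hij h''.1, mul_one]
  · rw [h', h, if_neg (hjK _ haK).not_gt]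
    simp only [true_and]
    split_ifs <;> ring

theorem treeTerm_insert_eq_sum {I : Finset (Fin n)} {j i : Fin n} {pj pi : ℚ}
    (hjI : ∀ x ∈ I, j < x) (hi : i ∈ I) {U : Finset (GArrow n)} {b : GArrow n}
    (hbt : b.tailStr = i) (hbtp : b.tailPos = pi) (hbh : b.headStr = j) (hbhp : b.headPos = pj)
    (hpi : ∀ a ∈ U, a.headStr = i → a.headPos ≠ pi)
    (hpj : ∀ a ∈ U, a.headStr = j → a.headPos ≠ pj)
    (hU : ∀ a ∈ U, ∀ a' ∈ U, a.headStr = a'.headStr → a.headPos = a'.headPos → a = a') :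
    treeTerm I j (insert b U) = b.sign * ∑ c ∈ I.filter (· ≤ i),
      treeTerm (I.filter (· < c)) j (U.filter (·.tailStr < c)) *
        treeTerm ((I.filter (c ≤ ·)).erase i) i
          ((U.filter (¬ ·.tailStr < c)).image (smoothArrow j i pj pi)) := by
  have hij : i ≠ j := (hjI i hi).ne'
  have hbU : b ∉ U := fun h => hpj b h hbh hbhp
  have hterm : ∀ c ∈ I.filter (· ≤ i),
      treeTerm (I.filter (· < c)) j (U.filter (·.tailStr < c)) *
        treeTerm ((I.filter (c ≤ ·)).erase i) i
          ((U.filter (¬ ·.tailStr < c)).image (smoothArrow j i pj pi)) =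
      (if IsTwoRootedForest I j i pi U then ∏ a ∈ U, arrowWeight a else 0) *
        if CutValid (U.filter (·.headStr = j)) (·.tailStr) (·.headPos)
          (fun a => Descends U a.tailStr) (Descends U i) i pj c
        then (-1) ^ ((U.filter (·.headStr = j)).filter
          fun a => c ≤ a.tailStr ∧ a.tailStr < i).card else 0 := by
    intro c hc
    have hK : ∀ x ∈ (I.filter (c ≤ ·)).erase i, j < x := fun x hx =>
      hjI x (Finset.mem_filter.1 (Finset.mem_of_mem_erase hx)).1
    have hiff := isPlanar_split_iff (pj := pj) hjI hi (Finset.mem_filter.1 hc).2 hpi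
    rw [treeTerm, treeTerm, isPlanarTreeDiagram_image_smoothArrow_iff hij
      (fun h => lt_irrefl _ (hK j h)) (Finset.notMem_erase i _), ite_zero_mul_ite_zero,
      ite_zero_mul_ite_zero]
    refine ite_congr (propext hiff) (fun h => ?_) fun _ => rfl
    rw [prod_arrowWeight_image hij hK (Finset.notMem_erase i _) (hiff.2 h).2, ← mul_assoc,
      Finset.prod_filter_mul_prod_filter_not, Finset.filter_filter, Finset.filter_filter]
    congr 3
    ext a
    simp only [Finset.mem_filter, not_lt]
    tauto
  rw [Finset.sum_congr rfl hterm, ← Finset.mul_sum, treeTerm,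
    isPlanarTreeDiagram_insert_iff hjI hi hbt hbh hbU, hbtp, hbhp]
  by_cases hF : IsTwoRootedForest I j i pi U
  · rw [sum_cutValid, Finset.prod_insert hbU, arrowWeight, hbt, hbh, if_neg (hjI i hi).not_gt]
    · simp only [hF, true_and, if_true]
      split_ifs <;> ring
    · exact fun a _ => .refl
    · exact fun a ha x hx => hx.mem hF.tail_mem (hF.tail_mem a (Finset.mem_filter.1 ha).1)
    · exact fun x hx => hx.mem hF.tail_mem hi
    · exact .refl
    · intro x hx
      by_cases hxi : x = i
      · exact Or.inl (hxi ▸ .refl)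
      · obtain ⟨a, ha, h | h, hax⟩ := hF.reach x hx hxi
        · exact Or.inl (descends_iff.2 (Or.inr ⟨a, ha, h, hax⟩))
        · exact Or.inr ⟨a, Finset.mem_filter.2 ⟨ha, h⟩, hax⟩
    · exact fun a ha => hF.tail_ne a (Finset.mem_filter.1 ha).1
    · intro a ha a' ha' h
      obtain ⟨ha, haj⟩ := Finset.mem_filter.1 ha
      obtain ⟨ha', haj'⟩ := Finset.mem_filter.1 ha'
      exact hU a ha a' ha' (haj.trans haj'.symm) h
    · intro a ha
      obtain ⟨ha, haj⟩ := Finset.mem_filter.1 ha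
      exact hpj a ha haj
  · simp [hF]

/-- The tree diagrams containing an arrow `b` from `i` to `j` are counted by pairs of trees in the
complement of `b` and in its smoothing. -/
theorem sum_treeTerm_insert {I : Finset (Fin n)} {j i : Fin n} {pj pi : ℚ}
    (hjI : ∀ x ∈ I, j < x) (hi : i ∈ I) {P : Finset (GArrow n)} {b : GArrow n}
    (hbt : b.tailStr = i) (hbtp : b.tailPos = pi) (hbh : b.headStr = j) (hbhp : b.headPos = pj)
    (hpi : ∀ a ∈ P, a.headStr = i → a.headPos ≠ pi)
    (hpj : ∀ a ∈ P, a.headStr = j → a.headPos ≠ pj)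
    (hP : ∀ a ∈ P, ∀ a' ∈ P, a.headStr = a'.headStr → a.headPos = a'.headPos → a = a') :
    ∑ U ∈ P.powerset, treeTerm I j (insert b U) = b.sign * ∑ c ∈ I.filter (· ≤ i),
      (∑ U ∈ P.powerset, treeTerm (I.filter (· < c)) j U) *
        ∑ V ∈ P.powerset, treeTerm ((I.filter (c ≤ ·)).erase i) i
          (V.image (smoothArrow j i pj pi)) := by
  have hij : i ≠ j := (hjI i hi).ne'
  rw [Finset.sum_congr rfl fun U hU => treeTerm_insert_eq_sum hjI hi hbt hbtp hbh hbhp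
    (fun a ha => hpi a (Finset.mem_powerset.1 hU ha))
    (fun a ha => hpj a (Finset.mem_powerset.1 hU ha))
    (fun a ha a' ha' => hP a (Finset.mem_powerset.1 hU ha) a' (Finset.mem_powerset.1 hU ha')),
    ← Finset.mul_sum, Finset.sum_comm]
  congr 1
  refine Finset.sum_congr rfl fun c _ => ?_
  have hK : j ∉ (I.filter (c ≤ ·)).erase i := fun h =>
    lt_irrefl _ (hjI j (Finset.mem_filter.1 (Finset.mem_of_mem_erase h)).1)
  symm
  refine sum_powerset_mul_sum_powerset P (fun a => a.tailStr < c)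
    (treeTerm (I.filter (· < c)) j)
    (fun V => treeTerm ((I.filter (c ≤ ·)).erase i) i (V.image (smoothArrow j i pj pi))) ?_ ?_
  · intro T _ hT a ha
    by_contra h
    exact hT (treeTerm_eq_zero_of_tail ha fun h' => h (Finset.mem_filter.1 h').2)
  · intro T _ hT a ha h
    refine hT (treeTerm_eq_zero_of_tail (Finset.mem_image_of_mem _ ha) ?_)
    rw [smoothArrow_tail_mem_iff hK (Finset.notMem_erase i _)]
    exact fun h' => absurd (Finset.mem_filter.1 (Finset.mem_of_mem_erase h')).2 (not_le.2 h)

end Skein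

/-- **Skein relation, sum form.**  Let `j < i₁ < … < i_r`, `I = {i₁,…,i_r}`,
`i = i_k ∈ I`, and let `(Gp, Gm, G0, Ginf)` be a skein quadruple of Gauss
diagrams on `n` strings at a crossing between strings `j` and `i`.  Then
`Z_{I,j}(G₊) − Z_{I,j}(G₋) = ∑_{m=1}^{k} Z_{I_m⁻, j}(G₊) · Z_{I_m⁺, i_k}(G₀)`,
where for the cut point `c = i_m` (with `m = 1,…,k`, i.e. `c ∈ I`, `c ≤ i`) one
sets `I_m⁻ = {x ∈ I : x < c}` and `I_m⁺ = {x ∈ I : x ≥ c} ∖ {i}`.  Moreover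
`Z_{I_m⁻, j}(G₊) = Z_{I_m⁻, j}(G₋)` for each such `m`, so the right-hand side
may equivalently be computed from `G₋`. -/
theorem skein_sum_form {n : ℕ} (I : Finset (Fin n)) (j : Fin n)
    (hjI : ∀ x ∈ I, j < x) (i : Fin n) (hi : i ∈ I)
    (Gp Gm G0 Ginf : GaussDiagram n)
    (hsk : IsSkeinQuadruple j i Gp Gm G0 Ginf) :
    (Z I j Gp - Z I j Gm
      = ∑ c ∈ I.filter (· ≤ i),
          Z (I.filter (· < c)) j Gp * Z ((I.filter (c ≤ ·)).erase i) i G0) ∧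
    (∀ c ∈ I.filter (· ≤ i),
      Z (I.filter (· < c)) j Gp = Z (I.filter (· < c)) j Gm) := by
  obtain ⟨-, a, ha, ha1, hends, hGm, hG0, -⟩ := hsk
  have hij : i ≠ j := (hjI i hi).ne'
  have hjn : j ∉ I := fun h => lt_irrefl _ (hjI j h)
  set P := Gp.arrows.erase a
  have hPG : ∀ {x}, x ∈ P → x ∈ Gp.arrows := fun h => Finset.mem_of_mem_erase h
  have haP : a ∉ P := Finset.notMem_erase a _
  have hGp : Gp.arrows = insert a P := (Finset.insert_erase ha).symm
  have hep : ∀ x ∈ P, ∀ s t : Bool, x.ep s ≠ a.ep t := fun x hx s t h =>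
    (Finset.mem_erase.1 hx).1 (Gp.endpoints_distinct x (hPG hx) a ha s t h).1
  have hP : ∀ x ∈ P, ∀ y ∈ P, x.headStr = y.headStr → x.headPos = y.headPos → x = y :=
    fun x hx y hy h h' =>
      (Gp.endpoints_distinct x (hPG hx) y (hPG hy) true true (Prod.ext h h')).1
  set a' : GArrow n := GArrow.mk a.headStr a.headPos a.tailStr a.tailPos (-1) with ha'def
  have ha'P : a' ∉ P := fun h => hep a' h true false rfl
  have hlow : ∀ c ∈ I.filter (· ≤ i), ∀ s, s = i ∨ s = j → s ∉ I.filter (· < c) := by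
    rintro c hc s (rfl | rfl) hs
    · exact absurd (Finset.mem_filter.1 hs).2 (not_lt.2 (Finset.mem_filter.1 hc).2)
    · exact hjn (Finset.mem_filter.1 hs).1
  have hZp : ∀ c ∈ I.filter (· ≤ i),
      Z (I.filter (· < c)) j Gp = ∑ U ∈ P.powerset, treeTerm (I.filter (· < c)) j U :=
    fun c hc => Z_eq_of_tail_notMem hGp haP
      (hlow c hc _ (hends.elim (fun h => Or.inr h.1) fun h => Or.inl h.1))
  have hZm : ∀ c ∈ I.filter (· ≤ i),
      Z (I.filter (· < c)) j Gm = ∑ U ∈ P.powerset, treeTerm (I.filter (· < c)) j U :=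
    fun c hc => Z_eq_of_tail_notMem hGm ha'P
      (hlow c hc _ (hends.elim (fun h => Or.inl h.2) fun h => Or.inr h.2))
  refine ⟨?_, fun c hc => (hZp c hc).trans (hZm c hc).symm⟩
  rw [Finset.sum_congr rfl fun c hc => by rw [hZp c hc, Z_eq_of_arrows_eq_image hij hG0]]
  rcases hends with ⟨hat, hah⟩ | ⟨hat, hah⟩
  · have hpj : posOn a j = a.tailPos := if_pos hat
    have hpi : posOn a i = a.headPos := if_neg (hat ▸ hij.symm)
    rw [Z_eq_of_tail_notMem hGp haP (hat ▸ hjn), Z_eq_of_arrows_eq_insert hGm ha'P,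
      sum_treeTerm_insert (b := a') hjI hi hah hpi.symm hat hpj.symm
        (fun x hx h h' => hep x hx true true (Prod.ext (h.trans hah.symm) (h'.trans hpi)))
        (fun x hx h h' => hep x hx true false (Prod.ext (h.trans hat.symm) (h'.trans hpj))) hP]
    simp only [ha'def]
    ring
  · have hpi : posOn a i = a.tailPos := if_pos hat
    have hpj : posOn a j = a.headPos := if_neg (hat ▸ hij)
    rw [Z_eq_of_tail_notMem hGm ha'P (show a.headStr ∉ I from hah ▸ hjn),
      Z_eq_of_arrows_eq_insert hGp haP,
      sum_treeTerm_insert hjI hi hat hpi.symm hah hpj.symm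
        (fun x hx h h' => hep x hx true false (Prod.ext (h.trans hat.symm) (h'.trans hpi)))
        (fun x hx h h' => hep x hx true true (Prod.ext (h.trans hah.symm) (h'.trans hpj))) hP, ha1]
    ring
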